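/- arXiv:1911.08549 — 3 statements merged into one kernel-verified Lean document; each statement's English description precedes it below -/
import Mathlib

section
/- Let p be a prime, q = p^m, and k a divisor of q−1 (with q even or k a divisor of (q−1)/2, so that Γ(k,q) is undirected), and suppose the generalized Paley graph Γ(k,q) is connected and strongly regular. Then Γ(k,q) is cartesian decomposable if and only if q is a square, k = (√q + 1)/2, and Γ(k,q) is isomorphic to K_{q'} □ K_{q'}, the cartesian product of two complete graphs on q' = √q vertices. -/
open scoped BigOperators

/-- The generalized Paley graph `Γ(k,q)` on a finite field `F`:
vertices are field elements, and `u, v` are adjacent iff `v - u = x^k` for some `x ≠ 0`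
(symmetrized via `fromRel`). -/
def gpGraph (F : Type) [Field F] (k : ℕ) : SimpleGraph F :=
  SimpleGraph.fromRel fun u v => ∃ x : F, x ≠ 0 ∧ v - u = x ^ k

/-- A finite graph is cartesian (box) decomposable if it is isomorphic to a box product
of two graphs, each with more than one vertex. -/
def CartesianDecomposable {V : Type} [Fintype V] (G : SimpleGraph V) : Prop :=
  ∃ (V₁ V₂ : Type) (i₁ : Fintype V₁) (i₂ : Fintype V₂)
    (G₁ : SimpleGraph V₁) (G₂ : SimpleGraph V₂),
    1 < @Fintype.card V₁ i₁ ∧ 1 < @Fintype.card V₂ i₂ ∧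
      Nonempty (G ≃g G₁.boxProd G₂)

/-- A graph is strongly regular if it is regular and there are constants `l, mu` such that
adjacent vertices have `l` common neighbours and distinct non-adjacent vertices have
`mu` common neighbours. -/
def IsStronglyRegular {V : Type} [Fintype V] (G : SimpleGraph V) : Prop :=
  ∃ d l mu : ℕ,
    (∀ v : V, (G.neighborSet v).ncard = d) ∧
    (∀ v w : V, G.Adj v w → (G.neighborSet v ∩ G.neighborSet w).ncard = l) ∧
    (∀ v w : V, v ≠ w → ¬ G.Adj v w → (G.neighborSet v ∩ G.neighborSet w).ncard = mu)

theorem IsStronglyRegular.of_iso {V W : Type} [Fintype V] [Fintype W] {G : SimpleGraph V}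
    {H : SimpleGraph W} (e : G ≃g H) (h : IsStronglyRegular G) : IsStronglyRegular H := by
  obtain ⟨d, l, mu, hd, hl, hmu⟩ := h
  have hN (v : W) : G.neighborSet (e.symm v) = e.symm '' H.neighborSet v := by
    ext x
    simp only [SimpleGraph.mem_neighborSet, Set.mem_image]
    refine ⟨fun hx => ⟨e x, ?_, e.symm_apply_apply x⟩, ?_⟩
    · simpa using e.map_adj_iff.2 hx
    · rintro ⟨y, hy, rfl⟩
      exact e.symm.map_adj_iff.2 hy
  have hinj : Function.Injective e.symm := e.symm.injective
  refine ⟨d, l, mu, fun v => ?_, fun v w hvw => ?_, fun v w hne hvw => ?_⟩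
  · rw [← hd (e.symm v), hN, Set.ncard_image_of_injective _ hinj]
  · rw [← hl _ _ (e.symm.map_adj_iff.2 hvw), hN, hN, ← Set.image_inter hinj,
      Set.ncard_image_of_injective _ hinj]
  · rw [← hmu _ _ (hinj.ne hne) (fun h => hvw (e.symm.map_adj_iff.1 h)), hN, hN,
      ← Set.image_inter hinj, Set.ncard_image_of_injective _ hinj]

/-- Two vertices of a box product whose coordinates are both distinct have a common neighbour
only if both coordinates are adjacent. -/
theorem mem_commonNeighbors_boxProd_of_ne {α β : Type*} {G : SimpleGraph α} {H : SimpleGraph β}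
    {a a' : α} {b b' : β} (ha : a ≠ a') (hb : b ≠ b') (x : α × β) :
    x ∈ (G.boxProd H).neighborSet (a, b) ∩ (G.boxProd H).neighborSet (a', b') ↔
      G.Adj a a' ∧ H.Adj b b' ∧ (x = (a, b') ∨ x = (a', b)) := by
  obtain ⟨x, y⟩ := x
  simp only [Set.mem_inter_iff, SimpleGraph.mem_neighborSet, SimpleGraph.boxProd_adj, Prod.mk.injEq]
  constructor
  · rintro ⟨⟨h1, rfl⟩ | ⟨h1, rfl⟩, ⟨h2, h3⟩ | ⟨h2, h3⟩⟩
    · exact absurd h3.symm hb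
    · subst h3; exact ⟨h1, h2.symm, by simp⟩
    · subst h3; exact ⟨h2.symm, h1, by simp⟩
    · exact absurd h3.symm ha
  · rintro ⟨h1, h2, ⟨rfl, rfl⟩ | ⟨rfl, rfl⟩⟩
    · exact ⟨Or.inr ⟨h2, rfl⟩, Or.inl ⟨h1.symm, rfl⟩⟩
    · exact ⟨Or.inl ⟨h1, rfl⟩, Or.inr ⟨h2.symm, rfl⟩⟩

theorem eq_top_of_isStronglyRegular_boxProd {V₁ V₂ : Type} [Fintype V₁] [Fintype V₂]
    {G₁ : SimpleGraph V₁} {G₂ : SimpleGraph V₂} {a a' : V₁} {b b' : V₂} (ha : G₁.Adj a a')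
    (hb : G₂.Adj b b') (h : IsStronglyRegular (G₁.boxProd G₂)) : G₁ = ⊤ := by
  obtain ⟨-, -, mu, -, -, hmu⟩ := h
  have hnadj {u u' : V₁} {v v' : V₂} (hu : u ≠ u') (hv : v ≠ v') :
      ¬ (G₁.boxProd G₂).Adj (u, v) (u', v') := by
    simp [SimpleGraph.boxProd_adj, hu, hv]
  have key {u u' : V₁} {v v' : V₂} (hu : u ≠ u') (hv : v ≠ v') :=
    hmu (u, v) (u', v') (by simp [hu]) (hnadj hu hv)
  have hpos : 0 < mu := by
    rw [← key ha.ne hb.ne, Set.ncard_pos]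
    exact ⟨(a, b'), (mem_commonNeighbors_boxProd_of_ne ha.ne hb.ne _).2 ⟨ha, hb, Or.inl rfl⟩⟩
  ext u u'
  refine ⟨fun h => h.ne, fun hu => ?_⟩
  rw [← key hu hb.ne, Set.ncard_pos] at hpos
  obtain ⟨x, hx⟩ := hpos
  exact ((mem_commonNeighbors_boxProd_of_ne hu hb.ne x).1 hx).1

theorem ncard_commonNeighbors_top_boxProd_top {α β : Type*} [Fintype α] {a a' : α} (b : β)
    (ha : a ≠ a') :
    (((⊤ : SimpleGraph α).boxProd (⊤ : SimpleGraph β)).neighborSet (a, b) ∩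
      ((⊤ : SimpleGraph α).boxProd (⊤ : SimpleGraph β)).neighborSet (a', b)).ncard + 2 =
        Fintype.card α := by
  have : ((⊤ : SimpleGraph α).boxProd (⊤ : SimpleGraph β)).neighborSet (a, b) ∩
      ((⊤ : SimpleGraph α).boxProd (⊤ : SimpleGraph β)).neighborSet (a', b) =
      (fun x => (x, b)) '' ({a, a'} : Set α)ᶜ := by
    ext ⟨x, y⟩
    simp only [Set.mem_inter_iff, SimpleGraph.mem_neighborSet, SimpleGraph.boxProd_adj,
      SimpleGraph.top_adj, Set.mem_image, Set.mem_compl_iff, Set.mem_insert_iff,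
      Set.mem_singleton_iff, Prod.mk.injEq]
    constructor
    · rintro ⟨⟨h1, h2⟩ | ⟨h1, h2⟩, ⟨h3, h4⟩ | ⟨h3, h4⟩⟩
      · exact ⟨x, by grind, rfl, h2⟩
      · exact absurd h2 h3
      · exact absurd h4 h1
      · exact absurd (h2.trans h4.symm) ha
    · rintro ⟨x, hx, rfl, rfl⟩
      grind
  rw [this, Set.ncard_image_of_injective _ (fun _ _ h => (Prod.mk.inj h).1),
    ← Nat.card_eq_fintype_card, ← Set.ncard_compl_add_ncard ({a, a'} : Set α), Set.ncard_pair ha]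

theorem IsStronglyRegular.card_eq_of_top_boxProd_top {V₁ V₂ : Type} [Fintype V₁] [Fintype V₂]
    [Nontrivial V₁] [Nontrivial V₂]
    (h : IsStronglyRegular ((⊤ : SimpleGraph V₁).boxProd (⊤ : SimpleGraph V₂))) :
    Fintype.card V₁ = Fintype.card V₂ := by
  obtain ⟨a, a', ha⟩ := exists_pair_ne V₁
  obtain ⟨b, b', hb⟩ := exists_pair_ne V₂
  obtain ⟨d, l, mu, -, hl, -⟩ := h
  rw [← ncard_commonNeighbors_top_boxProd_top b ha, ← ncard_commonNeighbors_top_boxProd_top a hb,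
    hl _ _ (SimpleGraph.boxProd_adj_left.2 ha)]
  rw [← hl (a, b) (a, b') (SimpleGraph.boxProd_adj_right.2 hb),
    ← Set.ncard_image_of_injective _ Prod.swap_injective]
  congr 2
  ext ⟨x, y⟩
  simp [SimpleGraph.boxProd_adj, and_comm, or_comm]

theorem exists_pow_eq_neg_one {F : Type*} [Field F] [Fintype F] {k : ℕ}
    (h : Even (Fintype.card F) ∨ 2 * k ∣ Fintype.card F - 1) : ∃ x : F, x ≠ 0 ∧ x ^ k = -1 := by
  by_cases h2 : ringChar F = 2
  · have := ringChar.eq_iff.1 h2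
    exact ⟨1, one_ne_zero, by rw [one_pow, CharTwo.neg_eq]⟩
  · have hodd := FiniteField.odd_card_of_char_ne_two h2
    obtain ⟨j, hj⟩ := h.resolve_left (fun he => by
      obtain ⟨r, hr⟩ := he
      omega)
    obtain ⟨a, ha⟩ := FiniteField.exists_nonsquare h2
    have ha0 : a ≠ 0 := by
      rintro rfl
      exact ha (IsSquare.zero)
    refine ⟨a ^ j, pow_ne_zero _ ha0, ?_⟩
    have hdiv : Fintype.card F / 2 = j * k := by
      rw [mul_assoc, mul_comm k j] at hj
      omega
    rw [← pow_mul, ← hdiv]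
    exact (FiniteField.pow_dichotomy h2 ha0).resolve_left
      (fun h1 => ha ((FiniteField.isSquare_iff h2 ha0).2 h1))

theorem ncard_neighborSet_gpGraph_zero {F : Type} [Field F] [Fintype F] {k : ℕ}
    (hkq : k ∣ Fintype.card F - 1) (hund : Even (Fintype.card F) ∨ 2 * k ∣ Fintype.card F - 1) :
    ((gpGraph F k).neighborSet 0).ncard * k = Fintype.card F - 1 := by
  classical
  obtain ⟨z, hz0, hz⟩ := exists_pow_eq_neg_one hund
  have hN : (gpGraph F k).neighborSet 0 =
      Units.val '' ((powMonoidHom k : Fˣ →* Fˣ).range : Set Fˣ) := by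
    ext y
    simp only [gpGraph, SimpleGraph.mem_neighborSet, SimpleGraph.fromRel_adj, sub_zero, zero_sub,
      Set.mem_image, SetLike.mem_coe, MonoidHom.mem_range, powMonoidHom_apply]
    constructor
    · rintro ⟨-, ⟨x, hx, rfl⟩ | ⟨x, hx, hxy⟩⟩
      · exact ⟨_, ⟨Units.mk0 x hx, rfl⟩, by simp⟩
      · refine ⟨_, ⟨Units.mk0 (z * x) (mul_ne_zero hz0 hx), rfl⟩, ?_⟩
        simp [mul_pow, hz, ← hxy]
    · rintro ⟨_, ⟨x, rfl⟩, rfl⟩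
      exact ⟨(Units.ne_zero _).symm, Or.inl ⟨x, x.ne_zero, by simp⟩⟩
  have hcard : Nat.card Fˣ = Fintype.card F - 1 := by
    rw [Nat.card_eq_fintype_card, Fintype.card_units]
  rw [hN, Set.ncard_image_of_injective _ Units.val_injective]
  have := IsCyclic.card_powMonoidHom_range (G := Fˣ) k
  rw [hcard, Nat.gcd_eq_right hkq] at this
  rw [← Nat.card_coe_set_eq, SetLike.coe_sort_coe, this, Nat.div_mul_cancel hkq]

theorem ncard_neighborSet_top_boxProd_top {n : ℕ} (x : Fin n × Fin n) :
    (((⊤ : SimpleGraph (Fin n)).boxProd (⊤ : SimpleGraph (Fin n))).neighborSet x).ncard =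
      2 * (n - 1) := by
  rw [← Nat.card_coe_set_eq, Nat.card_eq_fintype_card, SimpleGraph.card_neighborSet_eq_degree,
    SimpleGraph.degree_boxProd]
  simp [two_mul]

theorem stmt0 (p m k q : ℕ) (hp : p.Prime) (hm : 0 < m) (hq : q = p ^ m)
    (F : Type) [Field F] [Fintype F] (hF : Fintype.card F = q)
    (hk : 0 < k) (hkq : k ∣ q - 1) (hund : Even q ∨ 2 * k ∣ q - 1)
    (hconn : (gpGraph F k).Connected) (hsrg : IsStronglyRegular (gpGraph F k)) :
    CartesianDecomposable (gpGraph F k) ↔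
      ∃ q' : ℕ, q = q' * q' ∧ 2 * k = q' + 1 ∧
        Nonempty (gpGraph F k ≃g
          (⊤ : SimpleGraph (Fin q')).boxProd (⊤ : SimpleGraph (Fin q'))) := by
  subst hF
  have hq1 : 1 < Fintype.card F := Fintype.one_lt_card
  constructor
  · rintro ⟨V₁, V₂, i₁, i₂, G₁, G₂, h₁, h₂, ⟨e⟩⟩
    have : Nontrivial V₁ := Fintype.one_lt_card_iff_nontrivial.1 h₁
    have : Nontrivial V₂ := Fintype.one_lt_card_iff_nontrivial.1 h₂
    have hc : (G₁.boxProd G₂).Connected := e.connected_iff.1 hconn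
    have hs := hsrg.of_iso e
    obtain ⟨a, a', ha⟩ : ∃ a a', G₁.Adj a a' :=
      ⟨_, hc.ofBoxProdLeft.preconnected.exists_adj_of_nontrivial (Classical.arbitrary V₁)⟩
    obtain ⟨b, b', hb⟩ : ∃ b b', G₂.Adj b b' :=
      ⟨_, hc.ofBoxProdRight.preconnected.exists_adj_of_nontrivial (Classical.arbitrary V₂)⟩
    obtain rfl := eq_top_of_isStronglyRegular_boxProd ha hb hs
    obtain rfl := eq_top_of_isStronglyRegular_boxProd hb ha
      (hs.of_iso (SimpleGraph.boxProdComm _ _))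
    have hcard := hs.card_eq_of_top_boxProd_top
    let e₁ : (⊤ : SimpleGraph V₁) ≃g (⊤ : SimpleGraph (Fin (Fintype.card V₁))) :=
      SimpleGraph.Iso.completeGraph (Fintype.equivFin V₁)
    let e₂ : (⊤ : SimpleGraph V₂) ≃g (⊤ : SimpleGraph (Fin (Fintype.card V₁))) :=
      SimpleGraph.Iso.completeGraph (Fintype.equivFinOfCardEq hcard.symm)
    let f : gpGraph F k ≃g (⊤ : SimpleGraph (Fin (Fintype.card V₁))).boxProd
        (⊤ : SimpleGraph (Fin (Fintype.card V₁))) :=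
      e.trans ⟨e₁.toEquiv.prodCongr e₂.toEquiv, by
        simp [SimpleGraph.boxProd_adj]⟩
    have hFcard : Fintype.card F = Fintype.card V₁ * Fintype.card V₁ := by
      simpa using Fintype.card_congr f.toEquiv
    refine ⟨Fintype.card V₁, by omega, ?_, ⟨f⟩⟩
    have hdeg : ((gpGraph F k).neighborSet 0).ncard = 2 * (Fintype.card V₁ - 1) := by
      rw [← ncard_neighborSet_top_boxProd_top (f 0)]
      exact Nat.card_congr (f.mapNeighborSet 0)
    have hmul := ncard_neighborSet_gpGraph_zero hkq hund
    rw [hdeg, hFcard] at hmul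
    obtain ⟨n, hn⟩ : ∃ n, Fintype.card V₁ = n + 2 := ⟨_, (Nat.sub_add_cancel h₁).symm⟩
    rw [hn] at hmul ⊢
    have h3 : (n + 2) * (n + 2) - 1 = (n + 1) * (n + 3) := by
      rw [show (n + 2) * (n + 2) = (n + 1) * (n + 3) + 1 by ring, Nat.add_sub_cancel]
    rw [h3, show n + 2 - 1 = n + 1 from rfl] at hmul
    exact Nat.eq_of_mul_eq_mul_left (Nat.succ_pos n) (by linarith)
  · rintro ⟨q', hq', -, ⟨e⟩⟩
    have h1 : 1 < q' := by
      by_contra! hle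
      have := Nat.mul_le_mul hle hle
      omega
    exact ⟨Fin q', Fin q', inferInstance, inferInstance, ⊤, ⊤, by simpa using h1,
      by simpa using h1, ⟨e⟩⟩
end

section
/- Let p be a prime and k, m, n, a, b, c, u positive integers with q = p^m, k | q−1, n = (q−1)/k, m = ab, n = bc, b > 1, u = (p^a−1)/c, such that c is a primitive divisor of p^a−1, n is a primitive divisor of p^m−1, and (p−1) | c. Let w_1, …, w_s be the distinct weights occurring among codewords of the irreducible cyclic code C_0 = C(u, p^a) (including the zero weight), with frequencies m_1, …, m_s respectively. Then the weights occurring among codewords of C = C(k, p^m) are exactly the numbers ℓ_1 w_1 + ⋯ + ℓ_s w_s over all s-tuples (ℓ_1,…,ℓ_s) of non-negative integers with ℓ_1 + ⋯ + ℓ_s = b, and for every integer w the number of codewords of C of weight w equals the sum, over all such tuples with ℓ_1 w_1 + ⋯ + ℓ_s w_s = w, of (b!/(ℓ_1!⋯ℓ_s!))·m_1^{ℓ_1}⋯m_s^{ℓ_s}. -/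
open scoped BigOperators

/-- `Ψ_b(x) = x^(b-1) + ⋯ + x + 1`. -/
def psi (b x : ℕ) : ℕ := ∑ i ∈ Finset.range b, x ^ i

/-- `n` is a primitive divisor of `p^m - 1`. -/
def IsPrimitiveDivisor (n p m : ℕ) : Prop :=
  n ∣ p ^ m - 1 ∧ ∀ t : ℕ, 1 ≤ t → t < m → ¬ n ∣ p ^ t - 1

/-- The codeword `c_γ` of the irreducible cyclic code `C(k,q)` of length `n`;
its `i`-th coordinate is `Tr_{q/p}(γ ω^(k i))`. -/
noncomputable def cycWord (p : ℕ) (F : Type) [Field F] [Fintype F] [Algebra (ZMod p) F]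
    (ω : F) (k n : ℕ) (γ : F) : Fin n → ZMod p :=
  fun i => Algebra.trace (ZMod p) F (γ * ω ^ (k * (i : ℕ)))

/-- The irreducible cyclic code `C(k,q)` as a finite set of codewords. -/
noncomputable def cycCode (p : ℕ) (F : Type) [Field F] [Fintype F] [Algebra (ZMod p) F]
    (ω : F) (k n : ℕ) : Finset (Fin n → ZMod p) :=
  Finset.image (cycWord p F ω k n) Finset.univ

/-- Hamming weight of a codeword: the number of nonzero coordinates. -/
def wt {p n : ℕ} (c : Fin n → ZMod p) : ℕ :=
  (Finset.univ.filter fun i => c i ≠ 0).card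

/-- `A_w`: the number of codewords of weight `w` in `C(k,q)`. -/
noncomputable def freq (p : ℕ) (F : Type) [Field F] [Fintype F] [Algebra (ZMod p) F]
    (ω : F) (k n w : ℕ) : ℕ :=
  ((cycCode p F ω k n).filter fun c => wt c = w).card

/-- A field element whose powers exhaust the nonzero elements yields a primitive `c`-th root of unity
generating the same codewords (in `𝔽₂` the element may be `0`). -/
theorem exists_isPrimitiveRoot_cycWord_eq {p : ℕ} {F : Type} [Field F] [Fintype F]
    [Algebra (ZMod p) F] {ω : F} (hω : ∀ x : F, x ≠ 0 → ∃ j : ℕ, ω ^ j = x) {u c : ℕ}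
    (huc : u * c = Fintype.card F - 1) :
    ∃ ζ : F, IsPrimitiveRoot ζ c ∧ cycWord p F ω u c = cycWord p F ζ 1 c := by
  classical
  have hcard : 1 < Fintype.card F := Fintype.one_lt_card
  by_cases h0 : ω = 0
  · have h01 : ∀ x : F, x ≠ 0 → x = 1 := by
      intro x hx
      obtain ⟨j, rfl⟩ := hω x hx
      rcases Nat.eq_zero_or_pos j with rfl | hj
      · simp
      · exact absurd (by simp [h0, hj.ne']) hx
    have hle : Fintype.card F ≤ 2 := by
      have hsub : (Finset.univ : Finset F) ⊆ {0, 1} := by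
        intro x _
        by_cases hx : x = 0
        · simp [hx]
        · simp [h01 x hx]
      exact (Finset.card_le_card hsub).trans Finset.card_le_two
    have hc : c = 1 := (mul_eq_one.mp (show u * c = 1 by omega)).2
    subst hc
    refine ⟨1, IsPrimitiveRoot.one, ?_⟩
    funext γ i
    simp [cycWord, Subsingleton.elim i 0]
  · have hgen : ∀ x : Fˣ, x ∈ Subgroup.zpowers (Units.mk0 ω h0) := by
      intro x
      obtain ⟨j, hj⟩ := hω x x.ne_zero
      exact ⟨j, Units.ext (by simpa using hj)⟩
    have hord : orderOf ω = Fintype.card F - 1 := by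
      have h := orderOf_eq_card_of_forall_mem_zpowers hgen
      rwa [Nat.card_eq_fintype_card, Fintype.card_units, ← orderOf_units, Units.val_mk0] at h
    have hprim : IsPrimitiveRoot ω (Fintype.card F - 1) := hord ▸ IsPrimitiveRoot.orderOf ω
    refine ⟨ω ^ u, hprim.pow (by omega) huc.symm, ?_⟩
    funext γ i
    simp [cycWord, pow_mul]

theorem adjoin_eq_top_of_isPrimitiveDivisor {p m n : ℕ} [Fact p.Prime] {K : Type} [Field K]
    [Fintype K] [Algebra (ZMod p) K] (hK : Fintype.card K = p ^ m)
    (hn : IsPrimitiveDivisor n p m) {ζ : K} (hζ : IsPrimitiveRoot ζ n) (hn0 : n ≠ 0) :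
    IntermediateField.adjoin (ZMod p) {ζ} = ⊤ := by
  classical
  set L := IntermediateField.adjoin (ZMod p) {ζ} with hL
  have hp1 : 1 < p := (Fact.out : p.Prime).one_lt
  have hm : Module.finrank (ZMod p) K = m := by
    have h := Module.card_eq_pow_finrank (K := ZMod p) (V := K)
    rw [ZMod.card, hK] at h
    exact (Nat.pow_right_injective hp1 h).symm
  have hLcard : Fintype.card L = p ^ Module.finrank (ZMod p) L := by
    have h := Module.card_eq_pow_finrank (K := ZMod p) (V := L)
    rwa [ZMod.card] at h
  have hζ0 : ζ ≠ 0 := hζ.ne_zero hn0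
  have hmem : ζ ∈ L := IntermediateField.mem_adjoin_simple_self (ZMod p) ζ
  have hpow : ζ ^ (p ^ Module.finrank (ZMod p) L - 1) = 1 := by
    have h := FiniteField.pow_card_sub_one_eq_one (⟨ζ, hmem⟩ : L)
      (fun h => hζ0 (congrArg Subtype.val h))
    rw [hLcard] at h
    simpa using congrArg Subtype.val h
  have hdvd := hζ.dvd_of_pow_eq_one _ hpow
  have hge : m ≤ Module.finrank (ZMod p) L := by
    by_contra! hlt
    exact hn.2 _ Module.finrank_pos hlt hdvd
  exact IntermediateField.eq_of_le_of_finrank_le le_top (by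
    rw [IntermediateField.finrank_top', hm]; exact hge)

theorem eq_zero_of_forall_trace_mul_pow {p m n : ℕ} [Fact p.Prime] {K : Type} [Field K]
    [Fintype K] [Algebra (ZMod p) K] (hK : Fintype.card K = p ^ m)
    (hn : IsPrimitiveDivisor n p m) {ζ : K} (hζ : IsPrimitiveRoot ζ n) (hn0 : n ≠ 0) {γ : K}
    (h : ∀ i < n, Algebra.trace (ZMod p) K (γ * ζ ^ i) = 0) : γ = 0 := by
  have hpow : ∀ i : ℕ, Algebra.trace (ZMod p) K (γ * ζ ^ i) = 0 := by
    intro i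
    rw [← Nat.div_add_mod i n, pow_add, pow_mul, hζ.pow_eq_one, one_pow, one_mul]
    exact h _ (Nat.mod_lt _ (Nat.pos_of_ne_zero hn0))
  have htop : Algebra.adjoin (ZMod p) {ζ} = ⊤ := by
    rw [← IntermediateField.adjoin_simple_toSubalgebra_of_isAlgebraic
      (Algebra.IsAlgebraic.isAlgebraic ζ), adjoin_eq_top_of_isPrimitiveDivisor hK hn hζ hn0,
      IntermediateField.top_toSubalgebra]
  refine (traceForm_nondegenerate (ZMod p) K).1 γ fun y => ?_
  have hy : y ∈ Algebra.adjoin (ZMod p) {ζ} := htop ▸ Algebra.mem_top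
  rw [Algebra.adjoin_singleton_eq_range_aeval] at hy
  obtain ⟨f, rfl⟩ := hy
  change Algebra.trace (ZMod p) K (γ * Polynomial.aeval ζ f) = 0
  rw [Polynomial.aeval_eq_sum_range,
    Finset.mul_sum, map_sum]
  exact Finset.sum_eq_zero fun i _ => by rw [mul_smul_comm, map_smul, hpow, smul_zero]

theorem cycWord_injective {p m n : ℕ} [Fact p.Prime] {K : Type} [Field K]
    [Fintype K] [Algebra (ZMod p) K] (hK : Fintype.card K = p ^ m)
    (hn : IsPrimitiveDivisor n p m) {ζ : K} (hζ : IsPrimitiveRoot ζ n) (hn0 : n ≠ 0) :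
    Function.Injective (cycWord p K ζ 1 n) := by
  intro x y hxy
  refine sub_eq_zero.mp (eq_zero_of_forall_trace_mul_pow hK hn hζ hn0 fun i hi => ?_)
  have h := congrFun hxy ⟨i, hi⟩
  simp only [cycWord, one_mul] at h
  rw [sub_mul, map_sub, h, sub_self]

theorem freq_eq_card_of_injective {p : ℕ} {K : Type} [Field K] [Fintype K] [Algebra (ZMod p) K]
    {ω : K} {k n : ℕ} (h : Function.Injective (cycWord p K ω k n)) (W : ℕ) :
    freq p K ω k n W = (Finset.univ.filter fun γ : K => wt (cycWord p K ω k n γ) = W).card := by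
  classical
  rw [freq, cycCode, Finset.filter_image, Finset.card_image_of_injective _ h]

theorem wt_cycWord_eq_card_nthRoots {p c : ℕ} {F : Type} [Field F] [Fintype F]
    [Algebra (ZMod p) F] {ζ : F} (hζ : IsPrimitiveRoot ζ c) (hc : 0 < c) (β : F) :
    wt (cycWord p F ζ 1 c β) = ((Polynomial.nthRootsFinset c (1 : F)).filter
      fun y => Algebra.trace (ZMod p) F (β * y) ≠ 0).card := by
  have : NeZero c := ⟨hc.ne'⟩
  refine Finset.card_bij (fun i _ => ζ ^ (i : ℕ)) ?_ ?_ ?_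
  · intro i hi
    simp only [cycWord, one_mul, Finset.mem_filter, Finset.mem_univ, true_and] at hi
    rw [Finset.mem_filter, Polynomial.mem_nthRootsFinset hc]
    exact ⟨by rw [← pow_mul, mul_comm, pow_mul, hζ.pow_eq_one, one_pow], hi⟩
  · intro i _ j _ hij
    exact Fin.ext (hζ.pow_inj i.2 j.2 hij)
  · intro y hy
    rw [Finset.mem_filter, Polynomial.mem_nthRootsFinset hc] at hy
    obtain ⟨i, hi, rfl⟩ := hζ.eq_pow_of_pow_eq_one hy.1
    exact ⟨⟨i, hi⟩, by simpa [cycWord] using hy.2, rfl⟩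

theorem trace_mul_pow_add_mul {p b : ℕ} {F E : Type} [Field F] [Fintype F]
    [Algebra (ZMod p) F] [Field E] [Fintype E] [Algebra (ZMod p) E] [Fact p.Prime] [Algebra F E]
    [IsScalarTower (ZMod p) F E] {θ : E} {η : F} (hη : algebraMap F E η = θ ^ b) (γ : E)
    (j t : ℕ) :
    Algebra.trace (ZMod p) E (γ * θ ^ (j + b * t)) =
      Algebra.trace (ZMod p) F (Algebra.trace F E (γ * θ ^ j) * η ^ t) := by
  rw [← Algebra.trace_trace (S := F), pow_add, pow_mul, ← hη, ← map_pow, ← mul_assoc,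
    mul_comm _ (algebraMap F E _), ← Algebra.smul_def, map_smul, smul_eq_mul, mul_comm (η ^ t)]

theorem wt_cycWord_mul {p b c : ℕ} {F E : Type} [Field F] [Fintype F]
    [Algebra (ZMod p) F] [Field E] [Fintype E] [Algebra (ZMod p) E] [Fact p.Prime] [Algebra F E]
    [IsScalarTower (ZMod p) F E] {θ : E} {η : F} (hη : algebraMap F E η = θ ^ b) (γ : E) :
    wt (cycWord p E θ 1 (b * c) γ) =
      ∑ j : Fin b, wt (cycWord p F η 1 c (Algebra.trace F E (γ * θ ^ (j : ℕ)))) := by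
  rw [mul_comm b c]
  simp only [wt, Finset.card_filter]
  rw [← finProdFinEquiv.sum_comp, Fintype.sum_prod_type, Finset.sum_comm]
  simp only [cycWord, one_mul, finProdFinEquiv_apply_val, trace_mul_pow_add_mul hη]

theorem trace_mul_pow_bijective {p a b c : ℕ} {F E : Type} [Field F] [Fintype F]
    [Algebra (ZMod p) F] [Field E] [Fintype E] [Algebra (ZMod p) E] [Fact p.Prime] [Algebra F E]
    [IsScalarTower (ZMod p) F E] (hF : Fintype.card F = p ^ a) (hE : Fintype.card E = p ^ (a * b))
    (hn : IsPrimitiveDivisor (b * c) p (a * b)) {θ : E} (hθ : IsPrimitiveRoot θ (b * c))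
    (hb : 0 < b) (hc : 0 < c) {η : F} (hη : algebraMap F E η = θ ^ b) :
    Function.Bijective fun (γ : E) (j : Fin b) => Algebra.trace F E (γ * θ ^ (j : ℕ)) := by
  classical
  refine (Fintype.bijective_iff_injective_and_card _).mpr ⟨fun x y hxy => ?_, ?_⟩
  · refine sub_eq_zero.mp (eq_zero_of_forall_trace_mul_pow hE hn hθ (by positivity) fun i _ => ?_)
    have h := congrFun hxy ⟨i % b, Nat.mod_lt _ hb⟩
    simp only at h
    rw [← Nat.mod_add_div i b, trace_mul_pow_add_mul hη, sub_mul, map_sub, h, sub_self, zero_mul,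
      map_zero]
  · rw [hE, Fintype.card_fun, hF, Fintype.card_fin, pow_mul]

/-- Counting tuples by the sum of a statistic, via the multinomial theorem. -/
theorem card_filter_sum_eq_sum_antidiagonalTuple {α : Type*} [Fintype α] (N : α → ℕ) {s : ℕ}
    {w μ : Fin s → ℕ} (hw : Function.Injective w) (hN : ∀ x, ∃ i, N x = w i)
    (hμ : ∀ i, (Finset.univ.filter fun x => N x = w i).card = μ i) (b W : ℕ) :
    (Finset.univ.filter fun f : Fin b → α => ∑ j, N (f j) = W).card =
      ∑ ℓ ∈ Finset.Nat.antidiagonalTuple s b,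
        if (∑ i : Fin s, ℓ i * w i) = W
        then Nat.multinomial Finset.univ ℓ * ∏ i : Fin s, μ i ^ ℓ i
        else 0 := by
  classical
  have hgen : ∑ x : α, (Polynomial.X : Polynomial ℕ) ^ N x =
      ∑ i : Fin s, Polynomial.C (μ i) * Polynomial.X ^ w i := by
    choose g hg using hN
    rw [← Finset.sum_fiberwise Finset.univ g]
    refine Finset.sum_congr rfl fun i _ => ?_
    have hfib : (Finset.univ.filter fun x => g x = i) = Finset.univ.filter fun x => N x = w i := by
      ext x
      simp [hg, hw.eq_iff]
    rw [hfib, Finset.sum_congr rfl (g := fun _ => (Polynomial.X : Polynomial ℕ) ^ w i)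
      (fun x hx => by rw [(Finset.mem_filter.mp hx).2]), Finset.sum_const, hμ, nsmul_eq_mul]
    simp
  have hanti : Finset.piAntidiag (Finset.univ : Finset (Fin s)) b =
      Finset.Nat.antidiagonalTuple s b := by
    ext ℓ
    simp [Finset.Nat.mem_antidiagonalTuple]
  have hpow := congrArg (fun P => Polynomial.coeff (P ^ b) W) hgen
  rw [Fintype.sum_pow, Finset.sum_pow_eq_sum_piAntidiag, hanti, Polynomial.finsetSum_coeff,
    Polynomial.finsetSum_coeff] at hpow
  rw [Finset.card_filter]
  refine Eq.trans ?_ (hpow.trans ?_)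
  · refine Finset.sum_congr rfl fun f _ => ?_
    rw [Finset.prod_pow_eq_pow_sum, Polynomial.coeff_X_pow]
    simp only [eq_comm]
  · refine Finset.sum_congr rfl fun ℓ _ => ?_
    simp only [mul_pow, ← pow_mul, Finset.prod_mul_distrib, Finset.prod_pow_eq_pow_sum,
      ← Polynomial.C_pow, ← map_prod]
    rw [← Polynomial.C_eq_natCast, ← mul_assoc, ← Polynomial.C_mul, Polynomial.coeff_C_mul_X_pow]
    simp only [eq_comm, mul_comm (w _), Nat.cast_id]

theorem stmt1 (p k m n a b c u : ℕ) (hp : p.Prime)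
    (hk : 0 < k) (ha : 0 < a) (hcpos : 0 < c) (hupos : 0 < u)
    (hkdvd : k ∣ p ^ m - 1) (hn : n * k = p ^ m - 1)
    (hm : m = a * b) (hnbc : n = b * c) (hb : 1 < b)
    (huc : u * c = p ^ a - 1)
    (hcprim : IsPrimitiveDivisor c p a) (hnprim : IsPrimitiveDivisor n p m)
    (hpc : (p - 1) ∣ c)
    (F E : Type) [Field F] [Fintype F] [Algebra (ZMod p) F]
    [Field E] [Fintype E] [Algebra (ZMod p) E]
    (hFcard : Fintype.card F = p ^ a) (hEcard : Fintype.card E = p ^ m)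
    (ω₀ : F) (hω₀ : ∀ x : F, x ≠ 0 → ∃ j : ℕ, ω₀ ^ j = x)
    (ω : E) (hω : ∀ x : E, x ≠ 0 → ∃ j : ℕ, ω ^ j = x)
    (s : ℕ) (w μ : Fin s → ℕ) (hwinj : Function.Injective w)
    (hocc : ∀ x ∈ cycCode p F ω₀ u c, ∃ i : Fin s, wt x = w i)
    (hocc' : ∀ i : Fin s, ∃ x ∈ cycCode p F ω₀ u c, wt x = w i)
    (hfreq : ∀ i : Fin s, freq p F ω₀ u c (w i) = μ i) :
    (∀ x ∈ cycCode p E ω k n, ∃ ℓ ∈ Finset.Nat.antidiagonalTuple s b,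
        wt x = ∑ i : Fin s, ℓ i * w i) ∧
    (∀ ℓ ∈ Finset.Nat.antidiagonalTuple s b,
        ∃ x ∈ cycCode p E ω k n, wt x = ∑ i : Fin s, ℓ i * w i) ∧
    (∀ W : ℕ, freq p E ω k n W =
        ∑ ℓ ∈ Finset.Nat.antidiagonalTuple s b,
          if (∑ i : Fin s, ℓ i * w i) = W
          then Nat.multinomial Finset.univ ℓ * ∏ i : Fin s, μ i ^ ℓ i
          else 0) := by
  classical
  have : Fact p.Prime := ⟨hp⟩
  subst hm hnbc
  obtain ⟨ζ, hζ, hζw⟩ := exists_isPrimitiveRoot_cycWord_eq (p := p) hω₀ (hFcard ▸ huc)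
  obtain ⟨θ, hθ, hθw⟩ := exists_isPrimitiveRoot_cycWord_eq (p := p) hω (u := k) (c := b * c)
    (by rw [hEcard, ← hn, mul_comm])
  have hb0 : 0 < b := by omega
  have hfinrank : ∀ {K : Type} [Field K] [Fintype K] [Algebra (ZMod p) K] {t : ℕ},
      Fintype.card K = p ^ t → Module.finrank (ZMod p) K = t := by
    intro K _ _ _ t h
    rw [Module.card_eq_pow_finrank (K := ZMod p), ZMod.card] at h
    exact Nat.pow_right_injective hp.two_le h
  obtain ⟨φ⟩ : Nonempty (F →ₐ[ZMod p] E) := FiniteField.nonempty_algHom_of_finrank_dvd (by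
    rw [hfinrank hFcard, hfinrank hEcard]
    exact dvd_mul_right a b)
  let _ : Algebra F E := φ.toRingHom.toAlgebra
  have : IsScalarTower (ZMod p) F E := IsScalarTower.of_algebraMap_eq fun x => (φ.commutes x).symm
  obtain ⟨η, hη, hηθ⟩ : ∃ η : F, IsPrimitiveRoot η c ∧ algebraMap F E η = θ ^ b := by
    have : NeZero c := ⟨hcpos.ne'⟩
    have hζE : IsPrimitiveRoot (algebraMap F E ζ) c :=
      hζ.map_of_injective (algebraMap F E).injective
    have hθb : IsPrimitiveRoot (θ ^ b) c := hθ.pow (by positivity) rfl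
    obtain ⟨i, -, hi⟩ := hζE.eq_pow_of_pow_eq_one hθb.pow_eq_one
    rw [← map_pow] at hi
    exact ⟨ζ ^ i, IsPrimitiveRoot.of_map_of_injective (hi ▸ hθb) (algebraMap F E).injective, hi⟩
  have hwt : ∀ β : F, wt (cycWord p F η 1 c β) = wt (cycWord p F ω₀ u c β) := fun β => by
    rw [hζw, wt_cycWord_eq_card_nthRoots hη hcpos, wt_cycWord_eq_card_nthRoots hζ hcpos]
  have hbij := trace_mul_pow_bijective hFcard hEcard hnprim hθ hb0 hcpos hηθ
  have hcount : ∀ W : ℕ, freq p E ω k (b * c) W =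
      ∑ ℓ ∈ Finset.Nat.antidiagonalTuple s b,
        if (∑ i : Fin s, ℓ i * w i) = W
        then Nat.multinomial Finset.univ ℓ * ∏ i : Fin s, μ i ^ ℓ i
        else 0 := by
    intro W
    rw [← card_filter_sum_eq_sum_antidiagonalTuple (fun β => wt (cycWord p F ω₀ u c β)) hwinj
      (fun β => hocc _ (Finset.mem_image_of_mem _ (Finset.mem_univ β)))
      (fun i => by
        rw [← hfreq i, freq_eq_card_of_injective]
        exact hζw ▸ cycWord_injective hFcard hcprim hζ hcpos.ne'),
      freq_eq_card_of_injective (hθw ▸ cycWord_injective hEcard hnprim hθ (by positivity))]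
    refine Finset.card_bijective _ hbij fun γ => ?_
    simp only [Finset.mem_filter, Finset.mem_univ, true_and]
    rw [hθw, wt_cycWord_mul hηθ]
    simp only [hwt]
  have hμpos : ∀ i, 0 < μ i := fun i => by
    obtain ⟨x, hx, hxw⟩ := hocc' i
    rw [← hfreq i]
    exact Finset.card_pos.mpr ⟨x, Finset.mem_filter.mpr ⟨hx, hxw⟩⟩
  refine ⟨fun x hx => ?_, fun ℓ hℓ => ?_, hcount⟩
  · have hpos : freq p E ω k (b * c) (wt x) ≠ 0 :=
      (Finset.card_pos (s := (cycCode p E ω k (b * c)).filter fun y => wt y = wt x)).mpr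
        ⟨x, Finset.mem_filter.mpr ⟨hx, rfl⟩⟩ |>.ne'
    rw [hcount] at hpos
    obtain ⟨ℓ, hℓ, hne⟩ := Finset.exists_ne_zero_of_sum_ne_zero hpos
    exact ⟨ℓ, hℓ, by_contra fun h => hne (if_neg fun h' => h h'.symm)⟩
  · have hpos : 0 < freq p E ω k (b * c) (∑ i : Fin s, ℓ i * w i) := by
      rw [hcount]
      refine lt_of_lt_of_le ?_ (Finset.single_le_sum (fun _ _ => Nat.zero_le _) hℓ)
      rw [if_pos rfl]
      exact Nat.mul_pos (Nat.multinomial_pos _ _) (Finset.prod_pos fun i _ => pow_pos (hμpos i) _)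
    obtain ⟨x, hx⟩ := Finset.card_pos.mp hpos
    exact ⟨x, (Finset.mem_filter.mp hx).1, (Finset.mem_filter.mp hx).2⟩
end

section
/- Let p and r be distinct primes with p ≡ 1 (mod 3), and let c, k, m, q, t be positive integers with m = 3t, q = p^m, c = (q−1)/3 and k = (3/r)·Ψ_r(q). Assume q ≡ 1 (mod r), gcd(3, r) = 1, and that c is a primitive divisor of p^m − 1. Let A and B be the (unique up to the sign of B) integers satisfying 4p^t = A² + 27B², A ≡ 1 (mod 3) and gcd(A, p) = 1. Then the weights occurring among codewords of C(k, q^r) are exactly the numbers w_{ℓ1,ℓ2,ℓ3} = ((p−1)/(3p))·( h·q + ( A·((ℓ2+ℓ3)/2 − ℓ1) + (9B/2)·(ℓ2 − ℓ3) )·p^t ), over all triples (ℓ1, ℓ2, ℓ3) of non-negative integers with h = ℓ1+ℓ2+ℓ3 satisfying 0 ≤ h ≤ r, and for every integer w the number of codewords of C(k, q^r) of weight w equals the sum, over all such triples with w_{ℓ1,ℓ2,ℓ3} = w, of binom(r,h)·(h!/(ℓ1! ℓ2! ℓ3!))·c^h. -/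
open scoped BigOperators

/-- The weight `w_{ℓ1,ℓ2,ℓ3}` of Theorem 5.1 (codes from `C(3,q)`), with `q = p^m`:
`((p-1)/(3p))·( h·q + ( A·((ℓ2+ℓ3)/2 - ℓ1) + (9B/2)·(ℓ2-ℓ3) )·p^t )`. -/
def cubicWeight (p t m : ℕ) (A B : ℤ) (ℓ1 ℓ2 ℓ3 : ℕ) : ℚ :=
  ((p : ℚ) - 1) / (3 * (p : ℚ)) *
    (((ℓ1 : ℚ) + (ℓ2 : ℚ) + (ℓ3 : ℚ)) * (p : ℚ) ^ m +
      ((A : ℚ) * (((ℓ2 : ℚ) + (ℓ3 : ℚ)) / 2 - (ℓ1 : ℚ)) +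
        9 * (B : ℚ) / 2 * ((ℓ2 : ℚ) - (ℓ3 : ℚ))) * (p : ℚ) ^ t)

/-- Two representations `a² + 27 b² = 4 p^t` with `p ∤ a` and `a ≡ 1 (mod 3)` agree up to the sign
of `b`. -/
lemma eq_of_sq_add_eq_four_mul_pow {p t : ℕ} (hp : p.Prime) (hp5 : 5 ≤ p) (ht : 0 < t)
    {A B a b : ℤ} (hAB : A ^ 2 + 27 * B ^ 2 = 4 * (p : ℤ) ^ t)
    (hab : a ^ 2 + 27 * b ^ 2 = 4 * (p : ℤ) ^ t)
    (hA : ¬ (p : ℤ) ∣ A) (ha : ¬ (p : ℤ) ∣ a) (hA3 : A ≡ 1 [ZMOD 3]) (ha3 : a ≡ 1 [ZMOD 3]) :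
    a = A ∧ (b = B ∨ b = -B) := by
  have hpZ : Prime (p : ℤ) := Nat.prime_iff_prime_int.mp hp
  have hppos : (0 : ℤ) < (p : ℤ) ^ t := by have := hp.pos; positivity
  have hp2 : ¬ (p : ℤ) ∣ 2 := by
    intro h
    have := Int.le_of_dvd (by norm_num) h
    omega
  have hb : ¬ (p : ℤ) ∣ b := by
    intro h
    apply ha
    apply hpZ.dvd_of_dvd_pow (n := 2)
    have h1 : (p : ℤ) ∣ 4 * (p : ℤ) ^ t := Dvd.dvd.mul_left (dvd_pow_self _ ht.ne') _
    have h2 : (p : ℤ) ∣ 27 * b ^ 2 := Dvd.dvd.mul_left (dvd_pow h (by norm_num)) _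
    have : a ^ 2 = 4 * (p : ℤ) ^ t - 27 * b ^ 2 := by linarith
    rw [this]
    exact dvd_sub h1 h2
  have key : ∀ b : ℤ, a ^ 2 + 27 * b ^ 2 = 4 * (p : ℤ) ^ t → (p : ℤ) ^ t ∣ A * b - a * B →
      a = A ∧ (b = B ∨ b = -B) := by
    rintro b hab ⟨Z, hZ⟩
    have h1 : (A * a + 27 * B * b) ^ 2 = ((p : ℤ) ^ t) ^ 2 * (16 - 27 * Z ^ 2) := by
      have : (A * a + 27 * B * b) ^ 2 + 27 * (A * b - a * B) ^ 2
        = (A ^ 2 + 27 * B ^ 2) * (a ^ 2 + 27 * b ^ 2) := by ring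
      rw [hAB, hab, hZ] at this
      linarith
    have hZ0 : Z = 0 := by
      by_contra hne
      have : 1 ≤ Z ^ 2 := by
        have := sq_nonneg Z
        have : Z ^ 2 ≠ 0 := pow_ne_zero 2 hne
        omega
      have h2 : ((p : ℤ) ^ t) ^ 2 * (16 - 27 * Z ^ 2) < 0 :=
        mul_neg_of_pos_of_neg (by positivity) (by linarith)
      have := sq_nonneg (A * a + 27 * B * b)
      linarith
    rw [hZ0, mul_zero] at hZ
    have h3 : b ^ 2 = B ^ 2 := by
      have h4 : A ^ 2 * b ^ 2 = a ^ 2 * B ^ 2 := by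
        have : A * b = a * B := by linarith
        rw [← mul_pow, this, mul_pow]
      have h5 : 4 * (p : ℤ) ^ t * (b ^ 2 - B ^ 2) = 0 := by
        linear_combination h4 - b ^ 2 * hAB + B ^ 2 * hab
      rcases mul_eq_zero.mp h5 with h6 | h6 <;> linarith
    have h7 : a ^ 2 = A ^ 2 := by rw [h3] at hab; linarith
    refine ⟨?_, sq_eq_sq_iff_eq_or_eq_neg.mp h3⟩
    rcases sq_eq_sq_iff_eq_or_eq_neg.mp h7 with h | h
    · exact h
    · unfold Int.ModEq at hA3 ha3
      omega
  have hprod : (p : ℤ) ^ t ∣ (A * b - a * B) * (A * b + a * B) :=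
    ⟨4 * (b ^ 2 - B ^ 2), by linear_combination b ^ 2 * hAB - B ^ 2 * hab⟩
  by_cases hd : (p : ℤ) ∣ A * b + a * B
  · have hnd : ¬ (p : ℤ) ∣ A * b - a * B := by
      intro h
      have : (p : ℤ) ∣ 2 * (A * b) := by
        have := dvd_add h hd
        ring_nf at this ⊢
        exact this
      rcases hpZ.dvd_or_dvd this with h | h
      · exact hp2 h
      · exact (hpZ.dvd_or_dvd h).elim hA hb
    have hco : IsCoprime ((p : ℤ) ^ t) (A * b - a * B) :=
      ((hpZ.coprime_iff_not_dvd).mpr hnd).pow_left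
    have := hco.dvd_of_dvd_mul_left hprod
    have h := key (-b) (by rw [neg_sq]; exact hab) (by
      rw [show A * -b - a * B = -(A * b + a * B) by ring]; exact this.neg_right)
    refine ⟨h.1, ?_⟩
    rcases h.2 with h | h
    · right; linarith
    · left; linarith
  · have hco : IsCoprime ((p : ℤ) ^ t) (A * b + a * B) :=
      ((hpZ.coprime_iff_not_dvd).mpr hd).pow_left
    exact key b hab (hco.dvd_of_dvd_mul_right hprod)

/-- A triple of integers with prescribed power sums is determined up to order by the
representation `4 p^t = A² + 27 B²`. -/
lemma cubic_triple {p t : ℕ} (hp : p.Prime) (hp3 : p ≡ 1 [MOD 3]) (ht : 0 < t)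
    {A B : ℤ} (hAB : 4 * (p : ℤ) ^ t = A ^ 2 + 27 * B ^ 2) (hA3 : A ≡ 1 [ZMOD 3])
    (hA : ¬ (p : ℤ) ∣ A) {s : Fin 3 → ℤ} (h1 : s 0 + s 1 + s 2 = 0)
    (h2 : s 0 ^ 2 + s 1 ^ 2 + s 2 ^ 2 = 6 * (p : ℤ) ^ (3 * t))
    {A' : ℤ} (hA' : ¬ (p : ℤ) ∣ A') (h3 : s 0 * s 1 * s 2 = (p : ℤ) ^ (3 * t) * A')
    (hmod : ∀ i, s i ≡ 1 [ZMOD 3]) :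
    ∃ σ : Equiv.Perm (Fin 3), s (σ 0) = A * p ^ t ∧ 2 * s (σ 1) = -(A + 9 * B) * p ^ t ∧
      2 * s (σ 2) = -(A - 9 * B) * p ^ t := by
  have hpZ : Prime (p : ℤ) := Nat.prime_iff_prime_int.mp hp
  have hp5 : 5 ≤ p := by
    have := hp.two_le
    unfold Nat.ModEq at hp3
    by_contra hlt
    have : p = 4 := by omega
    subst this
    revert hp; decide
  have hP0 : (p : ℤ) ^ t ≠ 0 := pow_ne_zero _ hpZ.ne_zero
  have hPmod : (p : ℤ) ^ t ≡ 1 [ZMOD 3] := by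
    have : (p : ℤ) ≡ 1 [ZMOD 3] := by exact_mod_cast (Int.natCast_modEq_iff.mpr hp3)
    simpa using this.pow t
  have hdiv : ∀ i, ∃ y : ℤ, s i = p ^ t * y ∧ ¬ (p : ℤ) ∣ y := by
    intro i
    have hroot : s i ^ 3 = ((p : ℤ) ^ t) ^ 3 * (3 * s i + A') := by
      rw [← pow_mul, mul_comm t 3]
      have h0 : s 0 = - s 1 - s 2 := by linarith
      rw [h0] at h2 h3
      have hq : s 1 ^ 2 + s 1 * s 2 + s 2 ^ 2 = 3 * (p : ℤ) ^ (3 * t) := by nlinarith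
      fin_cases i
      · simp only [Fin.zero_eta, h0]
        linear_combination h3 + (- s 1 - s 2) * hq
      · simp only [Fin.mk_one]
        linear_combination h3 + s 1 * hq
      · simp only [Fin.reduceFinMk]
        linear_combination h3 + s 2 * hq
    have hps : (p : ℤ) ∣ s i := by
      apply hpZ.dvd_of_dvd_pow (n := 3)
      rw [hroot]
      exact Dvd.dvd.mul_right (dvd_pow (dvd_pow_self _ ht.ne') (by norm_num)) _
    have hnd : ¬ (p : ℤ) ∣ 3 * s i + A' := fun h =>
      hA' ((dvd_add_right (Dvd.dvd.mul_left hps 3)).mp h)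
    obtain ⟨y, hy⟩ : (p : ℤ) ^ t ∣ s i := by
      rw [← Int.pow_dvd_pow_iff (n := 3) (by norm_num), hroot]
      exact dvd_mul_right _ _
    refine ⟨y, hy, fun h => hnd ?_⟩
    rw [hy, mul_pow] at hroot
    have := mul_left_cancel₀ (pow_ne_zero 3 hP0) hroot
    rw [hy, ← this]
    exact dvd_pow h (by norm_num)
  choose y hy hyp using hdiv
  have hy1 : y 0 + y 1 + y 2 = 0 := by
    apply mul_left_cancel₀ hP0
    rw [mul_add, mul_add, ← hy, ← hy, ← hy, h1, mul_zero]
  have hy2 : y 0 ^ 2 + y 1 ^ 2 + y 2 ^ 2 = 6 * (p : ℤ) ^ t := by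
    apply mul_left_cancel₀ (pow_ne_zero 2 hP0)
    have : ((p : ℤ) ^ t) ^ 2 * (6 * (p : ℤ) ^ t) = 6 * (p : ℤ) ^ (3 * t) := by ring
    rw [this, ← h2, hy 0, hy 1, hy 2]
    ring
  have hym : ∀ i, y i ≡ 1 [ZMOD 3] := by
    intro i
    have h := hmod i
    rw [hy i] at h
    have h' := (hPmod.mul_right (y i)).symm.trans h
    simpa using h'
  have hσ : ∃ τ : Equiv.Perm (Fin 3), y (τ 1) ≡ y (τ 2) [ZMOD 9] := by
    have a0 := hym 0
    have a1 := hym 1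
    have a2 := hym 2
    have : y 1 ≡ y 2 [ZMOD 9] ∨ y 0 ≡ y 2 [ZMOD 9] ∨ y 1 ≡ y 0 [ZMOD 9] := by
      unfold Int.ModEq at *
      omega
    rcases this with h | h | h
    · exact ⟨1, h⟩
    · exact ⟨Equiv.swap 0 1, h⟩
    · exact ⟨Equiv.swap 0 2, h⟩
  obtain ⟨τ, hτ⟩ := hσ
  have hτ1 : y (τ 0) + y (τ 1) + y (τ 2) = 0 := by
    rw [← hy1, ← Fin.sum_univ_three (fun i => y (τ i)), ← Fin.sum_univ_three y, Equiv.sum_comp τ]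
  have hτ2 : y (τ 0) ^ 2 + y (τ 1) ^ 2 + y (τ 2) ^ 2 = 6 * (p : ℤ) ^ t := by
    rw [← hy2, ← Fin.sum_univ_three (fun i => y (τ i) ^ 2), ← Fin.sum_univ_three (fun i => y i ^ 2),
      Equiv.sum_comp τ (fun i => y i ^ 2)]
  obtain ⟨e, he⟩ := hτ.dvd
  have hrep : y (τ 0) ^ 2 + 27 * e ^ 2 = 4 * (p : ℤ) ^ t := by
    have h1 : y (τ 2) = y (τ 1) + 9 * e := by linarith
    have h0 : y (τ 0) = - 2 * y (τ 1) - 9 * e := by linarith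
    rw [h1, h0] at hτ2
    rw [h0]
    nlinarith
  obtain ⟨h0, he'⟩ := eq_of_sq_add_eq_four_mul_pow hp hp5 ht hAB.symm hrep hA (hyp _) hA3 (hym _)
  rcases he' with he' | he'
  · subst he'
    refine ⟨τ, ?_, ?_, ?_⟩
    · rw [hy, h0]; ring
    · rw [hy]; linear_combination (p : ℤ) ^ t * (hτ1 - he - h0)
    · rw [hy]; linear_combination (p : ℤ) ^ t * (hτ1 + he - h0)
  · refine ⟨(Equiv.swap 1 2).trans τ, ?_, ?_, ?_⟩
    · have : ((Equiv.swap 1 2).trans τ) 0 = τ 0 := by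
        simp only [Equiv.trans_apply]; rfl
      rw [this, hy, h0]; ring
    · have : ((Equiv.swap 1 2).trans τ) 1 = τ 2 := by simp
      rw [this, hy]; linear_combination (p : ℤ) ^ t * (hτ1 + he - h0 + 9 * he')
    · have : ((Equiv.swap 1 2).trans τ) 2 = τ 1 := by simp
      rw [this, hy]; linear_combination (p : ℤ) ^ t * (hτ1 - he - h0 - 9 * he')

lemma not_dvd_choose_of_base_repunit {p a : ℕ} (hp : p.Prime) (ha : 3 * a + 1 = p) {b : ℕ}
    (hb1 : 1 ≤ b) (hb : b ≤ 3) (m c : ℕ) (hc : 3 * c + 1 = p ^ m) : ¬ p ∣ (b * c).choose c := by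
  induction m generalizing c with
  | zero =>
    have : c = 0 := by simpa using hc
    subst this
    simpa using hp.one_lt.ne'
  | succ m ih =>
    have hpm : 3 ∣ p ^ m - 1 := by
      have h := Nat.sub_dvd_pow_sub_pow p 1 m
      rw [one_pow] at h
      exact Dvd.dvd.trans ⟨a, by omega⟩ h
    obtain ⟨d, hd⟩ := hpm
    have hpm1 : 1 ≤ p ^ m := Nat.one_le_pow _ _ hp.pos
    have hd' : 3 * d + 1 = p ^ m := by omega
    have hcd : c = p * d + a := by
      have : 3 * c + 1 = 3 * (p * d + a) + 1 := by
        rw [hc, pow_succ, ← hd']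
        have : 3 * (p * d + a) + 1 = 3 * d * p + (3 * a + 1) := by ring
        rw [this, ha]; ring
      omega
    have hbc : b * c = p * (b * d) + b * a := by rw [hcd]; ring
    have hap : a < p := by omega
    have hbap : b * a < p := by nlinarith
    have := Fact.mk hp
    have hl := Choose.choose_modEq_choose_mod_mul_choose_div_nat (n := b * c) (k := c) (p := p)
    have e1 : b * c % p = b * a := by rw [hbc, Nat.mul_add_mod, Nat.mod_eq_of_lt hbap]
    have e2 : b * c / p = b * d := by
      rw [hbc, Nat.mul_add_div hp.pos, Nat.div_eq_of_lt hbap, add_zero]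
    have e3 : c % p = a := by rw [hcd, Nat.mul_add_mod, Nat.mod_eq_of_lt hap]
    have e4 : c / p = d := by rw [hcd, Nat.mul_add_div hp.pos, Nat.div_eq_of_lt hap, add_zero]
    rw [e1, e2, e3, e4] at hl
    intro hdvd
    have := (hl.dvd_iff dvd_rfl).mp hdvd
    rcases hp.dvd_mul.mp this with h | h
    · have h1 := (Nat.choose_mul_factorial_mul_factorial (n := b * a) (k := a) (by nlinarith))
      have h2 : p ∣ (b * a).factorial := by
        rw [← h1, mul_assoc]; exact Dvd.dvd.mul_right h _
      exact absurd ((hp.dvd_factorial).mp h2) (by omega)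
    · exact ih d hd' h

lemma not_dvd_multinomial_three {p a : ℕ} (hp : p.Prime) (ha : 3 * a + 1 = p) (m c : ℕ)
    (hc : 3 * c + 1 = p ^ m) : ¬ p ∣ Nat.multinomial Finset.univ (fun _ : Fin 3 => c) := by
  have hspec := Nat.multinomial_spec (s := Finset.univ) (f := fun _ : Fin 3 => c)
  simp only [Finset.prod_const, Finset.sum_const, Finset.card_univ, Fintype.card_fin,
    smul_eq_mul] at hspec
  have h3 := Nat.choose_mul_factorial_mul_factorial (n := 3 * c) (k := c) (by omega)
  have h2 := Nat.choose_mul_factorial_mul_factorial (n := 2 * c) (k := c) (by omega)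
  rw [show 3 * c - c = 2 * c by omega] at h3
  rw [show 2 * c - c = c by omega] at h2
  have : Nat.multinomial Finset.univ (fun _ : Fin 3 => c)
      = (3 * c).choose c * (2 * c).choose c := by
    apply Nat.eq_of_mul_eq_mul_left (pow_pos (Nat.factorial_pos c) 3)
    rw [hspec, ← h3, ← h2]
    ring
  rw [this, hp.dvd_mul]
  rintro (h | h)
  · exact not_dvd_choose_of_base_repunit hp ha (by norm_num) (by norm_num) m c hc h
  · exact not_dvd_choose_of_base_repunit hp ha (by norm_num) (by norm_num) m c hc h

lemma AddChar.map_finset_sum_eq_prod {ι A M : Type} [AddCommMonoid A] [CommMonoid M]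
    (ψ : AddChar A M) (s : Finset ι) (f : ι → A) : ψ (∑ i ∈ s, f i) = ∏ i ∈ s, ψ (f i) := by
  classical
  induction s using Finset.induction_on with
  | empty => simp
  | insert a s ha ih => rw [Finset.sum_insert ha, Finset.prod_insert ha, map_add_eq_mul, ih]

section CubicSums

variable (p : ℕ) [Fact p.Prime] {K : Type} [Field K] [Fintype K]
  [Algebra (ZMod p) K]

/-- The number of `x` in `K` with `Tr (y x³) = a`. -/
noncomputable def cubeCount (y : K) (a : ZMod p) : ℕ :=
  (Finset.univ.filter fun x : K => Algebra.trace (ZMod p) K (y * x ^ 3) = a).card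

/-- The cubic exponential sum `∑ x, ζ ^ Tr (y x³)`, written as an integer; see
`cubeSum_eq_sum_addChar`. -/
noncomputable def cubeSum (y : K) : ℤ := cubeCount p y 0 - cubeCount p y 1

/-- The canonical additive character of `K`. -/
noncomputable def traceChar (K : Type) [Field K] [Algebra (ZMod p) K] : AddChar K ℂ :=
  (ZMod.stdAddChar (N := p)).compAddMonoidHom (Algebra.trace (ZMod p) K).toAddMonoidHom

lemma exists_trace_ne_zero (y : K) (hy : y ≠ 0) : ∃ z : K, Algebra.trace (ZMod p) K (y * z) ≠ 0 := by
  by_contra! h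
  exact hy ((traceForm_nondegenerate (ZMod p) K).1 y fun z => h z)

lemma traceChar_isPrimitive : (traceChar p K).IsPrimitive := by
  apply AddChar.IsPrimitive.of_ne_one
  obtain ⟨z, hz⟩ := exists_trace_ne_zero p (1 : K) one_ne_zero
  intro h
  have h1 : ZMod.stdAddChar (N := p) (Algebra.trace (ZMod p) K z) = 1 :=
    DFunLike.congr_fun h z
  rw [one_mul] at hz
  apply hz
  apply ZMod.injective_stdAddChar
  rw [h1, AddChar.map_zero_eq_one]

lemma card_eq_sum_cubeCount (y : K) : ∑ a : ZMod p, cubeCount p y a = Fintype.card K := by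
  rw [← Finset.card_univ]
  exact (Finset.card_eq_sum_card_fiberwise (fun x _ => Finset.mem_univ _)).symm

lemma cubeCount_eq_one (hcube : ∀ a : ZMod p, a ≠ 0 → ∃ b : K, b ^ 3 = algebraMap (ZMod p) K a)
    (y : K) {a : ZMod p} (ha : a ≠ 0) : cubeCount p y a = cubeCount p y 1 := by
  obtain ⟨b, hb⟩ := hcube a ha
  have hb0 : b ≠ 0 := by
    rintro rfl
    rw [zero_pow (by norm_num)] at hb
    exact ha ((map_eq_zero _).mp hb.symm)
  symm
  apply Finset.card_equiv (Equiv.mulLeft₀ b hb0)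
  intro x
  have : y * (b * x) ^ 3 = a • (y * x ^ 3) := by
    rw [mul_pow, hb, Algebra.smul_def]; ring
  simp only [Finset.mem_filter, Finset.mem_univ, true_and, Equiv.mulLeft₀_apply, this, map_smul,
    smul_eq_mul]
  constructor
  · intro h; rw [h, mul_one]
  · intro h; exact mul_left_cancel₀ ha (by rw [h, mul_one])

lemma cubeCount_zero_add
    (hcube : ∀ a : ZMod p, a ≠ 0 → ∃ b : K, b ^ 3 = algebraMap (ZMod p) K a) (y : K) :
    (cubeCount p y 0 : ℤ) + (p - 1) * cubeCount p y 1 = Fintype.card K := by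
  rw [← card_eq_sum_cubeCount p y, ← Finset.add_sum_erase _ _ (Finset.mem_univ 0),
    Finset.sum_congr rfl (fun a ha => cubeCount_eq_one p hcube y (Finset.ne_of_mem_erase ha)),
    Finset.sum_const, Finset.card_erase_of_mem (Finset.mem_univ _), Finset.card_univ, ZMod.card]
  have := (Fact.out : p.Prime).one_le
  push_cast [smul_eq_mul, Nat.cast_sub this]
  rfl

lemma cubeSum_eq_sum_addChar
    (hcube : ∀ a : ZMod p, a ≠ 0 → ∃ b : K, b ^ 3 = algebraMap (ZMod p) K a) (y : K) :
    (cubeSum p y : ℂ) = ∑ x : K, traceChar p K (y * x ^ 3) := by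
  have h1 : ∑ x : K, traceChar p K (y * x ^ 3)
      = ∑ a : ZMod p, (cubeCount p y a : ℂ) * ZMod.stdAddChar a := by
    rw [← Finset.sum_fiberwise_of_maps_to
      (g := fun x : K => Algebra.trace (ZMod p) K (y * x ^ 3)) (fun x _ => Finset.mem_univ _)]
    refine Finset.sum_congr rfl fun a _ => ?_
    rw [Finset.sum_congr rfl (g := fun _ => (ZMod.stdAddChar a : ℂ))]
    · rw [Finset.sum_const, nsmul_eq_mul]; rfl
    · intro x hx
      rw [← (Finset.mem_filter.mp hx).2]; rfl
  have h2 : ∑ a ∈ Finset.univ.erase (0 : ZMod p), (ZMod.stdAddChar a : ℂ) = -1 := by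
    have h := AddChar.sum_eq_zero_of_ne_one (ψ := ZMod.stdAddChar (N := p)) (by
      have := ZMod.isPrimitive_stdAddChar p (a := 1) one_ne_zero
      rwa [AddChar.mulShift_one] at this)
    rw [← Finset.add_sum_erase _ _ (Finset.mem_univ 0), AddChar.map_zero_eq_one] at h
    linear_combination h
  rw [h1, ← Finset.add_sum_erase _ _ (Finset.mem_univ 0), AddChar.map_zero_eq_one,
    Finset.sum_congr rfl (g := fun a => (cubeCount p y 1 : ℂ) * ZMod.stdAddChar a)
      (fun a ha => by rw [cubeCount_eq_one p hcube y (Finset.ne_of_mem_erase ha)]),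
    ← Finset.mul_sum, h2, cubeSum]
  push_cast
  ring

lemma sum_cubeSum_pow [DecidableEq K]
    (hcube : ∀ a : ZMod p, a ≠ 0 → ∃ b : K, b ^ 3 = algebraMap (ZMod p) K a) (j : ℕ) :
    ∑ y : K, cubeSum p y ^ j = (Fintype.card K : ℤ) *
      (Finset.univ.filter fun v : Fin j → K => ∑ i, v i ^ 3 = 0).card := by
  have h : ((∑ y : K, cubeSum p y ^ j : ℤ) : ℂ) = ((Fintype.card K : ℤ) *
      (Finset.univ.filter fun v : Fin j → K => ∑ i, v i ^ 3 = 0).card : ℤ) := by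
    push_cast
    simp_rw [cubeSum_eq_sum_addChar p hcube, Fintype.sum_pow]
    rw [Finset.sum_comm]
    have : ∀ v : Fin j → K, ∑ y : K, ∏ i, traceChar p K (y * v i ^ 3)
        = if ∑ i, v i ^ 3 = 0 then (Fintype.card K : ℂ) else 0 := by
      intro v
      rw [Finset.sum_congr rfl (g := fun y => traceChar p K (y * ∑ i, v i ^ 3)),
        AddChar.sum_mulShift _ (traceChar_isPrimitive p)]
      · push_cast; rfl
      · intro y _
        rw [Finset.mul_sum]
        exact (AddChar.map_finset_sum_eq_prod _ _ _).symm
    rw [Finset.sum_congr rfl fun v _ => this v, ← Finset.sum_filter, Finset.sum_const,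
      nsmul_eq_mul, mul_comm]
  exact_mod_cast h

lemma cubeSum_zero : cubeSum p (0 : K) = Fintype.card K := by
  simp [cubeSum, cubeCount]

lemma cubeSum_mul_pow_three (y u : K) (hu : u ≠ 0) : cubeSum p (y * u ^ 3) = cubeSum p y := by
  have : ∀ a, cubeCount p (y * u ^ 3) a = cubeCount p y a := by
    intro a
    apply Finset.card_equiv (Equiv.mulLeft₀ u hu)
    intro x
    simp [mul_pow, mul_assoc]
  simp [cubeSum, this]

end CubicSums

section Generator

lemma sum_range_mul {M : Type} [AddCommMonoid M] (f : ℕ → M) (k n : ℕ) :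
    ∑ i ∈ Finset.range (k * n), f i
      = ∑ j ∈ Finset.range n, ∑ s ∈ Finset.range k, f (k * j + s) := by
  induction n with
  | zero => simp
  | succ n ih => rw [Nat.mul_succ, Finset.sum_range_add, ih, Finset.sum_range_succ]

variable {K : Type} [Field K] [Fintype K] [DecidableEq K]

lemma sum_pow_eq_sum_filter {M : Type} [AddCommMonoid M] (f : K → M) {d : K} {n : ℕ}
    (hn : 0 < n) (hd : IsPrimitiveRoot d n) :
    ∑ i ∈ Finset.range n, f (d ^ i) = ∑ u ∈ Finset.univ.filter (fun u : K => u ^ n = 1), f u := by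
  have : NeZero n := ⟨hn.ne'⟩
  apply Finset.sum_nbij (fun i => d ^ i)
  · intro i _
    simp only [Finset.mem_filter, Finset.mem_univ, true_and]
    rw [← pow_mul, mul_comm, pow_mul, hd.pow_eq_one, one_pow]
  · intro i hi j hj hij
    exact hd.pow_inj (Finset.mem_range.mp hi) (Finset.mem_range.mp hj) hij
  · intro u hu
    simp only [Finset.coe_filter, Finset.mem_univ, true_and, Set.mem_ofPred_eq] at hu
    obtain ⟨i, hi, rfl⟩ := hd.eq_pow_of_pow_eq_one hu
    exact ⟨i, by simpa using hi, rfl⟩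
  · intro i _; rfl

lemma sum_pow_eq_sum_erase_zero {M : Type} [AddCommMonoid M] (f : K → M) {g : K} {n : ℕ}
    (hn : n + 1 = Fintype.card K) (hn0 : 0 < n) (hg : IsPrimitiveRoot g n) :
    ∑ i ∈ Finset.range n, f (g ^ i) = ∑ u ∈ Finset.univ.erase 0, f u := by
  rw [sum_pow_eq_sum_filter f hn0 hg]
  congr 1
  ext u
  simp only [Finset.mem_filter, Finset.mem_univ, true_and, Finset.mem_erase, and_true]
  constructor
  · rintro h rfl
    rw [zero_pow hn0.ne'] at h
    exact zero_ne_one h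
  · intro h
    have := FiniteField.pow_card_sub_one_eq_one u h
    rwa [← hn, Nat.add_sub_cancel] at this

/-- Summing over the nonzero elements by cosets of the group of nonzero cubes. -/
lemma sum_erase_zero_of_cubic_invariant {M : Type} [AddCommMonoid M] (f : K → M) {g : K} {c : ℕ}
    (hc : 3 * c + 1 = Fintype.card K) (hc0 : 0 < c) (hg : IsPrimitiveRoot g (3 * c))
    (hf : ∀ y u, u ≠ 0 → f (y * u ^ 3) = f y) :
    ∑ u ∈ Finset.univ.erase 0, f u = c • (f 1 + f g + f (g ^ 2)) := by
  have hg0 : g ≠ 0 := hg.ne_zero (by omega)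
  rw [← sum_pow_eq_sum_erase_zero f hc (by omega) hg, sum_range_mul,
    Finset.sum_congr rfl (g := fun _ => f 1 + f g + f (g ^ 2)), Finset.sum_const,
    Finset.card_range]
  intro j _
  have : ∀ s, f (g ^ (3 * j + s)) = f (g ^ s) := fun s => by
    rw [add_comm, pow_add, mul_comm 3 j, pow_mul, hf _ _ (pow_ne_zero _ hg0)]
  simp [Finset.sum_range_succ, this]

/-- Cubing covers the nonzero cubes three times each. -/
lemma sum_erase_zero_comp_pow_three {M : Type} [AddCommMonoid M] (f : K → M) {g d : K} {c : ℕ}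
    (hc : 3 * c + 1 = Fintype.card K) (hc0 : 0 < c) (hg : IsPrimitiveRoot g (3 * c))
    (hd : IsPrimitiveRoot d c) :
    ∑ u ∈ Finset.univ.erase 0, f (u ^ 3) = 3 • ∑ i ∈ Finset.range c, f (d ^ i) := by
  rw [← sum_pow_eq_sum_erase_zero (fun u => f (u ^ 3)) hc (by omega) hg,
    sum_pow_eq_sum_filter f hc0 hd,
    ← sum_pow_eq_sum_filter f hc0 (hg.pow (by omega) rfl : IsPrimitiveRoot (g ^ 3) c),
    mul_comm, sum_range_mul, Finset.sum_congr rfl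
      (g := fun _ => ∑ i ∈ Finset.range c, f ((g ^ 3) ^ i)), Finset.sum_const, Finset.card_range]
  intro j _
  refine Finset.sum_congr rfl fun i _ => ?_
  rw [← pow_mul, ← pow_mul, show (c * j + i) * 3 = 3 * c * j + 3 * i by ring, pow_add, pow_mul,
    hg.pow_eq_one, one_pow, one_mul]

end Generator

section CubeEquations

variable {K : Type} [Field K] [Fintype K] [DecidableEq K]

lemma card_sum_cubes_one :
    (Finset.univ.filter fun v : Fin 1 → K => ∑ i, v i ^ 3 = 0).card = 1 := by
  rw [Finset.card_eq_one]
  refine ⟨0, ?_⟩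
  ext v
  simp [funext_iff]

lemma card_sum_cubes_two {ζ : K} (hζ : IsPrimitiveRoot ζ 3) :
    (Finset.univ.filter fun v : Fin 2 → K => ∑ i, v i ^ 3 = 0).card
      = 1 + 3 * (Fintype.card K - 1) := by
  have h3 : (Finset.univ.filter fun u : K => u ^ 3 = 1).card = 3 := by
    have := sum_pow_eq_sum_filter (fun _ : K => (1 : ℕ)) (by norm_num) hζ
    simpa using this.symm
  have h1 : (Finset.univ.filter fun v : Fin 2 → K => ∑ i, v i ^ 3 = 0).card
      = ∑ z : K, (Finset.univ.filter fun x : K => z ^ 3 + x ^ 3 = 0).card := by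
    simp_rw [Finset.card_filter]
    rw [← Fintype.sum_prod_type' (f := fun z x : K => if z ^ 3 + x ^ 3 = 0 then 1 else 0)]
    exact Fintype.sum_equiv (finTwoArrowEquiv K) _ _ fun v => by simp [Fin.sum_univ_two]
  have h2 : ∀ z : K, z ≠ 0 → (Finset.univ.filter fun x : K => z ^ 3 + x ^ 3 = 0).card = 3 := by
    intro z hz
    refine Eq.trans ?_ h3
    symm
    apply Finset.card_equiv (Equiv.mulLeft₀ (-z) (neg_ne_zero.mpr hz))
    intro u
    have : z ^ 3 + (-z * u) ^ 3 = z ^ 3 * (1 - u ^ 3) := by ring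
    simp only [Finset.mem_filter, Finset.mem_univ, true_and, Equiv.mulLeft₀_apply, this,
      mul_eq_zero, pow_eq_zero_iff, hz, false_or, sub_eq_zero, ne_eq, OfNat.ofNat_ne_zero,
      not_false_eq_true]
    exact eq_comm
  rw [h1, ← Finset.add_sum_erase _ _ (Finset.mem_univ 0),
    Finset.sum_congr rfl (fun z hz => h2 z (Finset.ne_of_mem_erase hz)), Finset.sum_const,
    Finset.card_erase_of_mem (Finset.mem_univ _), Finset.card_univ, smul_eq_mul, mul_comm]
  congr 1
  rw [Finset.card_eq_one]
  refine ⟨0, ?_⟩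
  ext v
  simp

lemma sum_pow_three_mul (i : ℕ) : ∑ x : K, x ^ (3 * i) =
    if Fintype.card K - 1 ∣ 3 * i ∧ 0 < i then -1 else 0 := by
  rcases Nat.eq_zero_or_pos i with rfl | hi
  · simp
  · have : ∑ x : K, x ^ (3 * i) = ∑ x : Kˣ, (x : K) ^ (3 * i) := by
      rw [← Finset.add_sum_erase _ _ (Finset.mem_univ 0), zero_pow (by omega), zero_add]
      symm
      apply Finset.sum_nbij (fun x : Kˣ => (x : K))
      · intro x _; simp
      · intro x _ y _ h; exact Units.ext h
      · intro x hx
        have hx : x ≠ 0 := by simpa using hx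
        exact ⟨Units.mk0 x hx, by simp, rfl⟩
      · intro x _; rfl
    rw [this, FiniteField.sum_pow_units]
    simp [hi]

/-- The number of affine points of the Fermat cubic, as an element of the field. -/
lemma card_sum_cubes_three {c : ℕ} (hc : 3 * c + 1 = Fintype.card K) (hc0 : 0 < c) :
    ((Finset.univ.filter fun v : Fin 3 → K => ∑ i, v i ^ 3 = 0).card : K)
      = Nat.multinomial Finset.univ (fun _ : Fin 3 => c) := by
  have hq : Fintype.card K - 1 = 3 * c := by omega
  have hind : ∀ z : K, (if z = 0 then (1 : K) else 0) = 1 - z ^ (3 * c) := by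
    intro z
    split_ifs with h
    · rw [h, zero_pow (by omega), sub_zero]
    · rw [← hq, FiniteField.pow_card_sub_one_eq_one z h, sub_self]
  have hT : ∀ i, ∑ x : K, (x ^ 3) ^ i = if c ∣ i ∧ 0 < i then -1 else 0 := by
    intro i
    simp_rw [← pow_mul]
    rw [sum_pow_three_mul, hq]
    simp only [Nat.mul_dvd_mul_iff_left (by norm_num : 0 < 3)]
  rw [Finset.card_filter]
  push_cast
  simp_rw [hind]
  rw [Finset.sum_sub_distrib]
  have hone : ∑ _v : Fin 3 → K, (1 : K) = 0 := by
    simp [Finset.card_univ]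
  rw [hone]
  simp_rw [Finset.sum_pow_eq_sum_piAntidiag]
  rw [Finset.sum_comm]
  have hk : ∀ k : Fin 3 → ℕ, ∑ v : Fin 3 → K,
      ((Nat.multinomial Finset.univ k : ℕ) : K) * ∏ i, (v i ^ 3) ^ k i
      = (Nat.multinomial Finset.univ k : ℕ) * ∏ i, if c ∣ k i ∧ 0 < k i then (-1 : K) else 0 := by
    intro k
    rw [← Finset.mul_sum]
    simp_rw [← hT]
    rw [Finset.prod_univ_sum, Fintype.piFinset_univ]
  simp_rw [hk]
  rw [Finset.sum_eq_single (fun _ => c)]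
  · simp only [dvd_refl, hc0, and_self, if_true, Finset.prod_const, Finset.card_univ,
      Fintype.card_fin]
    ring
  · intro k hkm hkc
    rw [Finset.prod_eq_zero_iff.mpr, mul_zero]
    by_contra! hne
    apply hkc
    have hle : ∀ i, c ≤ k i := by
      intro i
      have := hne i (Finset.mem_univ i)
      have : c ∣ k i ∧ 0 < k i := by
        by_contra h
        rw [if_neg h] at this
        exact this rfl
      exact Nat.le_of_dvd this.2 this.1
    have hsum : ∑ i, k i = 3 * c := (Finset.mem_piAntidiag.mp hkm).1
    rw [Fin.sum_univ_three] at hsum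
    have h0 := hle 0
    have h1 := hle 1
    have h2 := hle 2
    ext i
    fin_cases i <;> simp <;> omega
  · intro h
    exact absurd (by simp [Finset.mem_piAntidiag, Finset.card_univ]) h

end CubeEquations

section CubicCode

variable {p t c : ℕ} [Fact p.Prime] {K : Type} [Field K] [Fintype K] [DecidableEq K]
  [Algebra (ZMod p) K]

/-- The weight of the codeword of `y` in the cyclic code generated by the element `d`. -/
noncomputable def orbitWeight (p c : ℕ) {K : Type} [Field K] [Algebra (ZMod p) K]
    (d y : K) : ℕ :=
  ((Finset.range c).filter fun j => Algebra.trace (ZMod p) K (y * d ^ j) ≠ 0).card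

omit [DecidableEq K] [Algebra (ZMod p) K] [Fact p.Prime] in
lemma exists_isPrimitiveRoot_of_card {n : ℕ} (hn : n + 1 = Fintype.card K) :
    ∃ g : K, IsPrimitiveRoot g n := by
  obtain ⟨g, hg⟩ := IsCyclic.exists_generator (α := Kˣ)
  refine ⟨g, ?_⟩
  have h := IsPrimitiveRoot.orderOf (g : K)
  rwa [orderOf_units, orderOf_eq_card_of_forall_mem_zpowers hg, Nat.card_units,
    Nat.card_eq_fintype_card, ← hn, Nat.add_sub_cancel] at h

omit [Fintype K] [DecidableEq K] in
/-- Elements of the prime field are cubes. -/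
lemma exists_pow_three_eq_algebraMap {g : K} (hg : IsPrimitiveRoot g (3 * c)) (hc0 : 0 < c)
    (hpc : p - 1 ∣ c) (a : ZMod p) (ha : a ≠ 0) : ∃ b : K, b ^ 3 = algebraMap (ZMod p) K a := by
  obtain ⟨e, he⟩ := hpc
  have hp1 : 0 < p - 1 := Nat.pos_of_ne_zero fun h => by simp [h] at he; omega
  have ha1 : algebraMap (ZMod p) K a ^ (p - 1) = 1 := by
    rw [← map_pow, ZMod.pow_card_sub_one_eq_one ha, map_one]
  have : NeZero (3 * c) := ⟨by omega⟩
  obtain ⟨i, -, hi⟩ := hg.eq_pow_of_pow_eq_one (ξ := algebraMap (ZMod p) K a) (by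
    rw [he, mul_comm 3, mul_assoc, pow_mul, ha1, one_pow])
  rw [← hi, ← pow_mul, hg.pow_eq_one_iff_dvd] at ha1
  have h3 : 3 * (p - 1) ∣ i * (p - 1) :=
    Dvd.dvd.trans ⟨e, by rw [he, mul_assoc]⟩ ha1
  obtain ⟨j, rfl⟩ := Nat.dvd_of_mul_dvd_mul_right hp1 h3
  exact ⟨g ^ j, by rw [← hi, ← pow_mul, mul_comm]⟩

lemma cubeCount_eq_add {g d : K} (hc : 3 * c + 1 = Fintype.card K) (hc0 : 0 < c)
    (hg : IsPrimitiveRoot g (3 * c)) (hd : IsPrimitiveRoot d c) (y : K) (a : ZMod p) :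
    cubeCount p y a = (if a = 0 then 1 else 0) +
      3 * ((Finset.range c).filter fun j => Algebra.trace (ZMod p) K (y * d ^ j) = a).card := by
  have h := sum_erase_zero_comp_pow_three
    (fun u => if Algebra.trace (ZMod p) K (y * u) = a then 1 else 0) hc hc0 hg hd
  rw [cubeCount, Finset.card_filter, ← Finset.add_sum_erase _ _ (Finset.mem_univ (0 : K)), h,
    Finset.card_filter, smul_eq_mul]
  congr 1
  simp [eq_comm]

lemma three_mul_orbitWeight {g d : K} (hc : 3 * c + 1 = Fintype.card K) (hc0 : 0 < c)
    (hg : IsPrimitiveRoot g (3 * c)) (hd : IsPrimitiveRoot d c) (hpc : p - 1 ∣ c) (y : K) :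
    3 * (p : ℤ) * orbitWeight p c d y = (p - 1) * (Fintype.card K - cubeSum p y) := by
  have h0 := cubeCount_eq_add (p := p) hc hc0 hg hd y 0
  have hs := cubeCount_zero_add p (exists_pow_three_eq_algebraMap hg hc0 hpc) y
  have hw : ((Finset.range c).filter fun j => Algebra.trace (ZMod p) K (y * d ^ j) = 0).card
      + orbitWeight p c d y = c := by
    rw [orbitWeight, Finset.card_filter_add_card_filter_not, Finset.card_range]
  rw [if_pos rfl] at h0
  have h3w : 3 * (orbitWeight p c d y : ℤ) = Fintype.card K - cubeCount p y 0 := by omega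
  rw [cubeSum]
  linear_combination (p : ℤ) * h3w - hs

lemma cubeSum_modEq {g d : K} (hc : 3 * c + 1 = Fintype.card K) (hc0 : 0 < c)
    (hg : IsPrimitiveRoot g (3 * c)) (hd : IsPrimitiveRoot d c) (y : K) :
    cubeSum p y ≡ 1 [ZMOD 3] := by
  have h0 := cubeCount_eq_add (p := p) hc hc0 hg hd y 0
  have h1 := cubeCount_eq_add (p := p) hc hc0 hg hd y 1
  rw [if_pos rfl] at h0
  rw [if_neg one_ne_zero] at h1
  unfold cubeSum Int.ModEq
  omega

omit [Fintype K] [DecidableEq K] in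
lemma orbitWeight_zero (d : K) : orbitWeight p c d 0 = 0 := by
  simp [orbitWeight]

/-- The moments of the three cubic sums. -/
lemma cubeSum_power_sums {g : K} (hc : 3 * c + 1 = Fintype.card K) (hc0 : 0 < c)
    (hg : IsPrimitiveRoot g (3 * c)) (hpc : p - 1 ∣ c) (hp3 : p ≡ 1 [MOD 3]) {m : ℕ}
    (hm : 0 < m) (hK : Fintype.card K = p ^ m) :
    cubeSum p (1 : K) + cubeSum p g + cubeSum p (g ^ 2) = 0 ∧
    cubeSum p (1 : K) ^ 2 + cubeSum p g ^ 2 + cubeSum p (g ^ 2) ^ 2 = 6 * (p : ℤ) ^ m ∧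
    ∃ A' : ℤ, ¬ (p : ℤ) ∣ A' ∧
      cubeSum p (1 : K) * cubeSum p g * cubeSum p (g ^ 2) = (p : ℤ) ^ m * A' := by
  have hp : p.Prime := Fact.out
  have hcube := exists_pow_three_eq_algebraMap (p := p) hg hc0 hpc
  have hmom : ∀ j, ((p : ℤ) ^ m) ^ j +
      c * (cubeSum p (1 : K) ^ j + cubeSum p g ^ j + cubeSum p (g ^ 2) ^ j)
      = (p : ℤ) ^ m * (Finset.univ.filter fun v : Fin j → K => ∑ i, v i ^ 3 = 0).card := by
    intro j
    have h := sum_cubeSum_pow p hcube j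
    rw [← Finset.add_sum_erase _ _ (Finset.mem_univ (0 : K)),
      sum_erase_zero_of_cubic_invariant _ hc hc0 hg
        (fun y u hu => by rw [cubeSum_mul_pow_three p y u hu]), cubeSum_zero, hK] at h
    push_cast at h
    simpa using h
  have hcZ : (c : ℤ) ≠ 0 := by exact_mod_cast hc0.ne'
  have hq : (p : ℤ) ^ m = 3 * c + 1 := by exact_mod_cast (hc.trans hK).symm
  have m1 := hmom 1
  have m2 := hmom 2
  have m3 := hmom 3
  have hζ : IsPrimitiveRoot (g ^ c) 3 := hg.pow (by omega) (mul_comm _ _)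
  rw [card_sum_cubes_one] at m1
  rw [card_sum_cubes_two hζ, ← hc, Nat.add_sub_cancel] at m2
  set s0 := cubeSum p (1 : K)
  set s1 := cubeSum p g
  set s2 := cubeSum p (g ^ 2)
  have e1 : s0 + s1 + s2 = 0 := by
    apply mul_left_cancel₀ hcZ
    push_cast at m1
    linear_combination m1
  have e2 : s0 ^ 2 + s1 ^ 2 + s2 ^ 2 = 6 * (p : ℤ) ^ m := by
    apply mul_left_cancel₀ hcZ
    push_cast at m2
    linear_combination m2 + (p : ℤ) ^ m * (-1) * hq
  refine ⟨e1, e2, ?_⟩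
  set M := (Finset.univ.filter fun v : Fin 3 → K => ∑ i, v i ^ 3 = 0).card with hM
  have hpM : ¬ (p : ℤ) ∣ M := by
    rw [Int.natCast_dvd_natCast]
    have : CharP K p := charP_of_injective_algebraMap (algebraMap (ZMod p) K).injective p
    rw [← CharP.cast_eq_zero_iff K p, hM, card_sum_cubes_three hc hc0, CharP.cast_eq_zero_iff K p]
    have hp2 := hp.two_le
    unfold Nat.ModEq at hp3
    exact not_dvd_multinomial_three hp (a := p / 3) (by omega) m c (hc.trans hK)
  have e3 : s0 * s1 * s2 = (p : ℤ) ^ m * (s0 * s1 * s2 - M + ((p : ℤ) ^ m) ^ 2) := by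
    have hs : s0 ^ 3 + s1 ^ 3 + s2 ^ 3 = 3 * (s0 * s1 * s2) := by
      have : s0 = - s1 - s2 := by linarith
      rw [this]; ring
    rw [hs] at m3
    linear_combination -m3 - s0 * s1 * s2 * hq
  refine ⟨_, ?_, e3⟩
  intro h
  have hpm : (p : ℤ) ∣ (p : ℤ) ^ m := dvd_pow_self _ hm.ne'
  have h1 : (p : ℤ) ∣ s0 * s1 * s2 := by rw [e3]; exact Dvd.dvd.mul_right hpm _
  have h2 : (p : ℤ) ∣ ((p : ℤ) ^ m) ^ 2 := dvd_pow hpm (by norm_num)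
  apply hpM
  have h3 := dvd_sub (dvd_add h1 h2) h
  rwa [show s0 * s1 * s2 + ((p : ℤ) ^ m) ^ 2 - (s0 * s1 * s2 - M + ((p : ℤ) ^ m) ^ 2) = (M : ℤ) by
    ring] at h3

/-- The weight distribution of the cubic code `C(3, p^(3t))`. -/
theorem exists_orbitWeight_distribution (hp3 : p ≡ 1 [MOD 3]) (ht : 0 < t)
    (hK : Fintype.card K = p ^ (3 * t)) (hc : 3 * c + 1 = p ^ (3 * t)) {d : K}
    (hd : IsPrimitiveRoot d c) {A B : ℤ} (hAB : 4 * (p : ℤ) ^ t = A ^ 2 + 27 * B ^ 2)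
    (hA3 : A ≡ 1 [ZMOD 3]) (hA : ¬ (p : ℤ) ∣ A) :
    ∃ W : Fin 3 → ℕ, (W 0 : ℚ) = cubicWeight p t (3 * t) A B 1 0 0 ∧
      (W 1 : ℚ) = cubicWeight p t (3 * t) A B 0 1 0 ∧
      (W 2 : ℚ) = cubicWeight p t (3 * t) A B 0 0 1 ∧
      (∀ {M : Type} [AddCommMonoid M] (f : ℕ → M), ∑ y : K, f (orbitWeight p c d y)
        = f 0 + c • (f (W 0) + f (W 1) + f (W 2))) ∧
      ∀ y : K, orbitWeight p c d y = 0 → y = 0 := by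
  have hp : p.Prime := Fact.out
  have hq2 : 2 ^ 3 ≤ p ^ (3 * t) :=
    (Nat.pow_le_pow_left hp.two_le 3).trans (Nat.pow_le_pow_right hp.pos (by omega))
  have hc0 : 0 < c := by omega
  have hcK : 3 * c + 1 = Fintype.card K := hc.trans hK.symm
  have hpc : p - 1 ∣ c := by
    have h1 : p ^ 3 - 1 ∣ 3 * c := by
      have := Nat.sub_dvd_pow_sub_pow (p ^ 3) 1 t
      rwa [one_pow, ← pow_mul, ← hc, Nat.add_sub_cancel] at this
    have h2 : 3 * (p - 1) ∣ p ^ 3 - 1 := by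
      have hp2 := hp.two_le
      unfold Nat.ModEq at hp3
      obtain ⟨a, rfl⟩ : ∃ a, p = 3 * a + 1 := ⟨p / 3, by omega⟩
      refine ⟨3 * a ^ 2 + 3 * a + 1, ?_⟩
      rw [Nat.add_sub_cancel, Nat.sub_eq_iff_eq_add (Nat.one_le_pow _ _ (by omega))]
      ring
    exact Nat.dvd_of_mul_dvd_mul_left (by norm_num : 0 < 3) (h2.trans h1)
  obtain ⟨g, hg⟩ := exists_isPrimitiveRoot_of_card hcK
  have h3w := three_mul_orbitWeight (p := p) hcK hc0 hg hd hpc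
  have hp0 : (p : ℤ) ≠ 0 := by exact_mod_cast hp.ne_zero
  obtain ⟨e1, e2, A', hA', e3⟩ :=
    cubeSum_power_sums (p := p) hcK hc0 hg hpc hp3 (by omega : 0 < 3 * t) hK
  obtain ⟨σ, hσ0, hσ1, hσ2⟩ := cubic_triple hp hp3 ht hAB hA3 hA
    (s := fun i => cubeSum p (g ^ (i : ℕ))) (by simpa using e1) (by simpa using e2) hA'
    (by simpa using e3) (fun i => cubeSum_modEq hcK hc0 hg hd _)
  have hpQ : (p : ℚ) ≠ 0 := by exact_mod_cast hp.ne_zero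
  have h3wQ : ∀ y : K, (orbitWeight p c d y : ℚ)
      = (p - 1) / (3 * p) * (p ^ (3 * t) - cubeSum p y) := by
    intro y
    have h := h3w y
    rw [hK] at h
    have h' : 3 * (p : ℚ) * orbitWeight p c d y = (p - 1) * (p ^ (3 * t) - cubeSum p y) := by
      exact_mod_cast h
    field_simp
    linear_combination h'
  have hinv : ∀ y u : K, u ≠ 0 → orbitWeight p c d (y * u ^ 3) = orbitWeight p c d y := by
    intro y u hu
    have h := h3wQ (y * u ^ 3)
    rw [cubeSum_mul_pow_three p y u hu, ← h3wQ] at h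
    exact_mod_cast h
  refine ⟨fun i => orbitWeight p c d (g ^ (σ i : ℕ)), ?_, ?_, ?_, ?_, ?_⟩
  · have h : (cubeSum p (g ^ (σ 0 : ℕ)) : ℚ) = A * p ^ t := by exact_mod_cast hσ0
    simp only [h3wQ, h, cubicWeight]
    push_cast
    ring
  · have h : 2 * (cubeSum p (g ^ (σ 1 : ℕ)) : ℚ) = -(A + 9 * B) * p ^ t := by exact_mod_cast hσ1
    have h : (cubeSum p (g ^ (σ 1 : ℕ)) : ℚ) = -(A + 9 * B) * p ^ t / 2 := by linarith
    simp only [h3wQ, h, cubicWeight]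
    push_cast
    ring
  · have h : 2 * (cubeSum p (g ^ (σ 2 : ℕ)) : ℚ) = -(A - 9 * B) * p ^ t := by exact_mod_cast hσ2
    have h : (cubeSum p (g ^ (σ 2 : ℕ)) : ℚ) = -(A - 9 * B) * p ^ t / 2 := by linarith
    simp only [h3wQ, h, cubicWeight]
    push_cast
    ring
  · intro M _ f
    rw [← Finset.add_sum_erase _ _ (Finset.mem_univ (0 : K)), orbitWeight_zero,
      sum_erase_zero_of_cubic_invariant (fun y => f (orbitWeight p c d y)) hcK hc0 hg
        (fun y u hu => by rw [hinv y u hu])]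
    congr 2
    have h := Equiv.sum_comp σ (fun i : Fin 3 => f (orbitWeight p c d (g ^ (i : ℕ))))
    simpa [Fin.sum_univ_three] using h.symm
  · intro y hy
    by_contra hy0
    have hsq : cubeSum p y = p ^ (3 * t) := by
      have h := h3w y
      rw [hy, hK, Nat.cast_zero, mul_zero, eq_comm, mul_eq_zero] at h
      have h2 : (2 : ℤ) ≤ p := by exact_mod_cast hp.two_le
      rcases h with h | h
      · omega
      · push_cast at h; linarith
    have hle : cubeSum p y ^ 2 ≤ 6 * (p : ℤ) ^ (3 * t) := by
      have : NeZero (3 * c) := ⟨by omega⟩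
      obtain ⟨i, -, rfl⟩ := hg.eq_pow_of_pow_eq_one (ξ := y) (by
        have := FiniteField.pow_card_sub_one_eq_one y hy0
        rwa [← hcK, Nat.add_sub_cancel] at this)
      have hi : cubeSum p (g ^ i) = cubeSum p (g ^ (i % 3)) := by
        conv_lhs => rw [← Nat.mod_add_div i 3, pow_add, mul_comm 3, pow_mul]
        exact cubeSum_mul_pow_three p _ _ (pow_ne_zero _ (hg.ne_zero (by omega)))
      rw [hi]
      have h3 : i % 3 < 3 := Nat.mod_lt _ (by norm_num)
      interval_cases i % 3
      · rw [pow_zero]; nlinarith [sq_nonneg (cubeSum p g), sq_nonneg (cubeSum p (g ^ 2))]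
      · rw [pow_one]; nlinarith [sq_nonneg (cubeSum p (1 : K)), sq_nonneg (cubeSum p (g ^ 2))]
      · nlinarith [sq_nonneg (cubeSum p (1 : K)), sq_nonneg (cubeSum p g)]
    have hq : (8 : ℤ) ≤ p ^ (3 * t) := by exact_mod_cast hq2
    rw [hsq] at hle
    nlinarith

end CubicCode

section Multinomial

open Polynomial

/-- The coefficients of `(1 + c (X^W₀ + X^W₁ + X^W₂))^r`. -/
lemma coeff_one_add_smul_pow (c r N : ℕ) (W : Fin 3 → ℕ) :
    ((1 + c • (X ^ W 0 + X ^ W 1 + X ^ W 2) : ℕ[X]) ^ r).coeff N =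
      ∑ ℓ ∈ Finset.range (r + 1) ×ˢ Finset.range (r + 1) ×ˢ Finset.range (r + 1),
        if ℓ.1 + ℓ.2.1 + ℓ.2.2 ≤ r ∧ N = ℓ.1 * W 0 + ℓ.2.1 * W 1 + ℓ.2.2 * W 2
        then Nat.choose r (ℓ.1 + ℓ.2.1 + ℓ.2.2) *
             Nat.multinomial Finset.univ ![ℓ.1, ℓ.2.1, ℓ.2.2] *
             c ^ (ℓ.1 + ℓ.2.1 + ℓ.2.2)
        else 0 := by
  have h1 : ((1 + c • (X ^ W 0 + X ^ W 1 + X ^ W 2) : ℕ[X]) ^ r) =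
      ∑ h ∈ Finset.range (r + 1), ∑ k ∈ Finset.piAntidiag (Finset.univ : Finset (Fin 3)) h,
        C (r.choose h * Nat.multinomial Finset.univ k * c ^ h) *
          X ^ (k 0 * W 0 + k 1 * W 1 + k 2 * W 2) := by
    rw [add_comm, add_pow]
    refine Finset.sum_congr rfl fun h _ => ?_
    rw [← Fin.sum_univ_three (fun i => (X : ℕ[X]) ^ W i), _root_.smul_pow,
      Finset.sum_pow_eq_sum_piAntidiag, one_pow, mul_one, Finset.smul_sum, Finset.sum_mul]
    refine Finset.sum_congr rfl fun k _ => ?_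
    simp only [Fin.prod_univ_three, nsmul_eq_mul, map_mul, pow_add, pow_mul', Nat.cast_pow,
      map_pow, ← C_eq_natCast, Nat.cast_id]
    ring
  rw [h1, ← Finset.sum_filter, finsetSum_coeff]
  simp_rw [finsetSum_coeff, coeff_C_mul, coeff_X_pow]
  rw [Finset.sum_sigma', ← Finset.sum_filter_of_ne (p := fun x : (_ : ℕ) × (Fin 3 → ℕ) =>
    N = x.2 0 * W 0 + x.2 1 * W 1 + x.2 2 * W 2)
    (by intro x _ hx; by_contra h; rw [if_neg h, mul_zero] at hx; exact hx rfl)]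
  refine Finset.sum_bij' (fun x _ => (x.2 0, x.2 1, x.2 2))
    (fun ℓ _ => ⟨ℓ.1 + ℓ.2.1 + ℓ.2.2, ![ℓ.1, ℓ.2.1, ℓ.2.2]⟩) ?_ ?_ ?_ ?_ ?_
  · rintro ⟨h, k⟩ hx
    simp only [Finset.mem_filter, Finset.mem_sigma, Finset.mem_range, Finset.mem_piAntidiag,
      Fin.sum_univ_three, Finset.mem_product] at hx ⊢
    obtain ⟨⟨h1, h2, -⟩, h3⟩ := hx
    refine ⟨⟨?_, ?_, ?_⟩, ?_, h3⟩ <;> omega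
  · rintro ⟨a, b, e⟩ hx
    simp only [Finset.mem_filter, Finset.mem_product, Finset.mem_range] at hx
    simp only [Finset.mem_filter, Finset.mem_sigma, Finset.mem_range, Finset.mem_piAntidiag,
      Fin.sum_univ_three]
    refine ⟨⟨by omega, by simp, by simp⟩, by simpa using hx.2.2⟩
  · rintro ⟨h, k⟩ hx
    simp only [Finset.mem_filter, Finset.mem_sigma, Finset.mem_piAntidiag,
      Fin.sum_univ_three] at hx
    have hk : ![k 0, k 1, k 2] = k := by ext i; fin_cases i <;> rfl
    simp only [hk, hx.1.2.1]
  · rintro ⟨a, b, e⟩ _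
    rfl
  · rintro ⟨h, k⟩ hx
    simp only [Finset.mem_filter, Finset.mem_sigma, Finset.mem_piAntidiag,
      Fin.sum_univ_three] at hx
    have hk : ![k 0, k 1, k 2] = k := by ext i; fin_cases i <;> rfl
    simp only [hk, hx.1.2.1]
    rw [if_pos hx.2, mul_one]

/-- The number of vectors of given total weight is a coefficient of a power of the weight
enumerator. -/
lemma card_filter_sum_eq_coeff {K : Type} [Fintype K] (w : K → ℕ) (r N : ℕ) :
    (Finset.univ.filter fun y : Fin r → K => ∑ s, w (y s) = N).card
      = ((∑ y : K, (X : ℕ[X]) ^ w y) ^ r).coeff N := by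
  rw [Fintype.sum_pow, finsetSum_coeff, Finset.card_filter]
  refine Finset.sum_congr rfl fun y _ => ?_
  rw [Finset.prod_pow_eq_pow_sum, coeff_X_pow]
  simp only [eq_comm]

end Multinomial

section Tower

variable {p m r c k n : ℕ} [Fact p.Prime]

lemma isPrimitiveRoot_of_forall_exists_pow {E : Type} [Field E] [Fintype E] {N : ℕ}
    (hN : N + 1 = Fintype.card E) (hN1 : 1 < N) {ω : E} (hω : ∀ x : E, x ≠ 0 → ∃ j : ℕ, ω ^ j = x) :
    IsPrimitiveRoot ω N := by
  obtain ⟨g, hg⟩ := exists_isPrimitiveRoot_of_card hN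
  obtain ⟨j, hj⟩ := hω g (hg.ne_zero (by omega))
  have hω0 : ω ≠ 0 := by
    rintro rfl
    rcases Nat.eq_zero_or_pos j with rfl | h
    · rw [pow_zero] at hj
      exact hg.ne_one hN1 hj.symm
    · rw [zero_pow h.ne'] at hj
      exact hg.ne_zero (by omega) hj.symm
  have h1 : orderOf ω ∣ N := by
    rw [orderOf_dvd_iff_pow_eq_one]
    have := FiniteField.pow_card_sub_one_eq_one ω hω0
    rwa [← hN, Nat.add_sub_cancel] at this
  have h2 : N ∣ orderOf ω := by
    rw [hg.eq_orderOf, ← hj]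
    exact orderOf_pow_dvd j
  rw [← Nat.dvd_antisymm h1 h2]
  exact IsPrimitiveRoot.orderOf ω

omit [Fact p.Prime] in
lemma length_eq (hq : 3 * c + 1 = p ^ m) (hk : r * k = 3 * psi r (p ^ m))
    (hn : n * k = p ^ (m * r) - 1) (hmr : 1 < p ^ (m * r)) : n = r * c := by
  have hk0 : 0 < k := Nat.pos_of_ne_zero fun h => by
    rw [h, mul_zero] at hn; omega
  apply Nat.eq_of_mul_eq_mul_right hk0
  have hg : psi r (p ^ m) * (3 * c) + 1 = p ^ (m * r) := by
    rw [psi, pow_mul, ← hq]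
    exact geom_sum_mul_add (3 * c) r
  rw [hn, ← hg, Nat.add_sub_cancel]
  linear_combination c * hk.symm

variable {K E : Type} [Field K] [Fintype K] [Algebra (ZMod p) K] [Field E] [Fintype E]
  [Algebra (ZMod p) E] [Algebra K E] [IsScalarTower (ZMod p) K E]

omit [Algebra (ZMod p) K] [Algebra (ZMod p) E] [IsScalarTower (ZMod p) K E] [Fact p.Prime] in
/-- An element of prime relative degree is separated by its powers under the trace form. -/
lemma trace_mul_pow_injective (hr : r.Prime) (hrank : Module.finrank K E = r) {β : E}
    (hβ : β ∉ (algebraMap K E).range) :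
    Function.Injective (fun (γ : E) (s : Fin r) => Algebra.trace K E (γ * β ^ (s : ℕ))) := by
  have hdeg : (minpoly K β).natDegree = r := by
    have hint : IsIntegral K β := Algebra.IsIntegral.isIntegral β
    have h1 : (minpoly K β).natDegree ∣ r := hrank ▸ minpoly.degree_dvd hint
    rcases (Nat.dvd_prime hr).mp h1 with h | h
    · exact absurd (minpoly.natDegree_eq_one_iff.mp h) hβ
    · exact h
  have hli : LinearIndependent K (fun s : Fin r => β ^ (s : ℕ)) :=
    hdeg ▸ linearIndependent_pow (K := K) β
  have : Nonempty (Fin r) := ⟨⟨0, hr.pos⟩⟩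
  have hspan := hli.span_eq_top_of_card_eq_finrank (by rw [hrank, Fintype.card_fin])
  intro γ γ' h
  rw [← sub_eq_zero]
  apply (traceForm_nondegenerate K E).1
  intro z
  have hz : z ∈ Submodule.span K (Set.range fun s : Fin r => β ^ (s : ℕ)) := by
    rw [hspan]; exact Submodule.mem_top
  have hle : Submodule.span K (Set.range fun s : Fin r => β ^ (s : ℕ))
      ≤ LinearMap.ker (Algebra.traceForm K E (γ - γ')) := by
    rw [Submodule.span_le]
    rintro _ ⟨s, rfl⟩
    have := congrFun h s
    rw [SetLike.mem_coe, LinearMap.mem_ker, Algebra.traceForm_apply, sub_mul, map_sub]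
    exact sub_eq_zero.mpr this
  exact hle hz

lemma wt_cycWord_eq_sum {ω : E} {d : K} (hn : n = r * c)
    (hd : algebraMap K E d = (ω ^ k) ^ r) (γ : E) : wt (cycWord p E ω k n γ) =
      ∑ s : Fin r, orbitWeight p c d (Algebra.trace K E (γ * (ω ^ k) ^ (s : ℕ))) := by
  have h1 : wt (cycWord p E ω k n γ) = ∑ i ∈ Finset.range n,
      if Algebra.trace (ZMod p) E (γ * (ω ^ k) ^ i) ≠ 0 then 1 else 0 := by
    rw [wt, Finset.card_filter, ← Fin.sum_univ_eq_sum_range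
      (fun i => if Algebra.trace (ZMod p) E (γ * (ω ^ k) ^ i) ≠ 0 then 1 else 0)]
    simp only [cycWord, pow_mul]
  rw [h1, hn, sum_range_mul, Finset.sum_comm, ← Fin.sum_univ_eq_sum_range
    (fun s => ∑ j ∈ Finset.range c, if Algebra.trace (ZMod p) E (γ * (ω ^ k) ^ (r * j + s)) ≠ 0
      then 1 else 0)]
  refine Finset.sum_congr rfl fun s _ => ?_
  rw [orbitWeight, Finset.card_filter]
  refine Finset.sum_congr rfl fun j _ => ?_
  have : γ * (ω ^ k) ^ (r * j + (s : ℕ)) = d ^ j • (γ * (ω ^ k) ^ (s : ℕ)) := by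
    rw [pow_add, pow_mul, ← hd, Algebra.smul_def, map_pow]; ring
  rw [this, ← Algebra.trace_trace (S := K), map_smul, smul_eq_mul, mul_comm]

/-- The code `C(k, q^r)` has the weight enumerator of the `r`-fold direct sum of `C(3, q)`. -/
theorem freq_eq_card_filter (hr : r.Prime) (h3r : Nat.Coprime 3 r) {ω : E} {d : K}
    (hrank : Module.finrank K E = r) (hcK : 3 * c + 1 = Fintype.card K) (hc0 : 0 < c)
    (hn : n = r * c) (hω : IsPrimitiveRoot (ω ^ k) n)
    (hd : algebraMap K E d = (ω ^ k) ^ r) (hzero : ∀ y : K, orbitWeight p c d y = 0 → y = 0)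
    (N : ℕ) : freq p E ω k n N =
      (Finset.univ.filter fun y : Fin r → K => ∑ s, orbitWeight p c d (y s) = N).card := by
  classical
  have hβ : ω ^ k ∉ (algebraMap K E).range := by
    rintro ⟨b, hb⟩
    have hb0 : b ≠ 0 := by
      rintro rfl
      rw [map_zero] at hb
      exact hω.ne_zero (by rw [hn]; exact (Nat.mul_pos hr.pos hc0).ne') hb.symm
    have h1 : (ω ^ k) ^ (3 * c) = 1 := by
      rw [← hb, ← map_pow, ← Nat.add_sub_cancel (n := 3 * c) (m := 1), hcK,
        FiniteField.pow_card_sub_one_eq_one b hb0, map_one]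
    rw [hω.pow_eq_one_iff_dvd, hn] at h1
    have h2 := Nat.dvd_of_mul_dvd_mul_right hc0 h1
    exact hr.one_lt.ne' (Nat.eq_one_of_dvd_coprimes h3r h2 dvd_rfl)
  have htr := trace_mul_pow_injective hr hrank hβ
  have hwt := wt_cycWord_eq_sum (p := p) (k := k) hn hd
  have hinj : Function.Injective (cycWord p E ω k n) := by
    intro γ γ' h
    rw [← sub_eq_zero]
    have hw : wt (cycWord p E ω k n (γ - γ')) = 0 := by
      rw [wt, Finset.card_eq_zero, Finset.filter_eq_empty_iff]
      intro i _
      have := congrFun h i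
      simp only [cycWord] at this
      simp only [cycWord, sub_mul, map_sub, this, sub_self, ne_eq, not_true, not_false_eq_true]
    rw [hwt, Finset.sum_eq_zero_iff] at hw
    apply htr
    ext s
    simpa using hzero _ (hw s (Finset.mem_univ s))
  have hcard : Fintype.card E = Fintype.card (Fin r → K) := by
    rw [Module.card_eq_pow_finrank (K := K) (V := E), hrank]
    simp
  have hbij := (Fintype.bijective_iff_injective_and_card _).mpr ⟨htr, hcard⟩
  rw [freq, cycCode, Finset.filter_image, Finset.card_image_of_injective _ hinj]
  apply Finset.card_equiv (Equiv.ofBijective _ hbij)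
  intro γ
  simp [hwt]

end Tower

theorem stmt8 (p r t m c k n : ℕ) (hp : p.Prime) (hr : r.Prime) (hpr : p ≠ r)
    (hp3 : Nat.ModEq 3 p 1) (ht : 0 < t) (hm : m = 3 * t)
    (hc : 3 * c = p ^ m - 1) (hk : r * k = 3 * psi r (p ^ m))
    (hq1 : Nat.ModEq r (p ^ m) 1) (h3r : Nat.Coprime 3 r)
    (hcprim : IsPrimitiveDivisor c p m)
    (A B : ℤ) (hAB : (4 * (p : ℤ) ^ t) = A ^ 2 + 27 * B ^ 2)
    (hA1 : Int.ModEq 3 A 1) (hAp : Int.gcd A (p : ℤ) = 1)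
    (E : Type) [Field E] [Fintype E] [Algebra (ZMod p) E]
    (hE : Fintype.card E = p ^ (m * r))
    (ω : E) (hω : ∀ x : E, x ≠ 0 → ∃ j : ℕ, ω ^ j = x)
    (hn : n * k = p ^ (m * r) - 1) :
    (∀ x ∈ cycCode p E ω k n, ∃ ℓ1 ℓ2 ℓ3 : ℕ, ℓ1 + ℓ2 + ℓ3 ≤ r ∧
        (wt x : ℚ) = cubicWeight p t m A B ℓ1 ℓ2 ℓ3) ∧
    (∀ ℓ1 ℓ2 ℓ3 : ℕ, ℓ1 + ℓ2 + ℓ3 ≤ r →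
        ∃ x ∈ cycCode p E ω k n, (wt x : ℚ) = cubicWeight p t m A B ℓ1 ℓ2 ℓ3) ∧
    (∀ W : ℕ, freq p E ω k n W =
        ∑ ℓ ∈ Finset.range (r + 1) ×ˢ Finset.range (r + 1) ×ˢ Finset.range (r + 1),
          if ℓ.1 + ℓ.2.1 + ℓ.2.2 ≤ r ∧
              (W : ℚ) = cubicWeight p t m A B ℓ.1 ℓ.2.1 ℓ.2.2
          then Nat.choose r (ℓ.1 + ℓ.2.1 + ℓ.2.2) *
               Nat.multinomial Finset.univ ![ℓ.1, ℓ.2.1, ℓ.2.2] *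
               c ^ (ℓ.1 + ℓ.2.1 + ℓ.2.2)
          else 0) := by
  classical
  have : Fact p.Prime := ⟨hp⟩
  have hm0 : m ≠ 0 := by omega
  have hq8 : 2 ^ 3 ≤ p ^ m :=
    (Nat.pow_le_pow_left hp.two_le 3).trans (Nat.pow_le_pow_right hp.pos (by omega))
  have hcq : 3 * c + 1 = p ^ m := by omega
  have hc0 : 0 < c := by omega
  have hqr : p ^ m ≤ p ^ (m * r) :=
    Nat.pow_le_pow_right hp.pos (Nat.le_mul_of_pos_right _ hr.pos)
  have hnrc : n = r * c := length_eq hcq hk hn (by omega)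
  have hA : ¬ (p : ℤ) ∣ A := by
    intro h
    have h1 := Int.dvd_coe_gcd h (dvd_refl (p : ℤ))
    rw [hAp] at h1
    exact (Nat.prime_iff_prime_int.mp hp).not_dvd_one h1
  have hωN : IsPrimitiveRoot ω (p ^ (m * r) - 1) :=
    isPrimitiveRoot_of_forall_exists_pow (by omega) (by omega) hω
  have hβ : IsPrimitiveRoot (ω ^ k) n := hωN.pow (by omega) (by rw [← hn, mul_comm])
  let _ : Fintype (GaloisField p m) := Fintype.ofFinite _
  have hK : Fintype.card (GaloisField p m) = p ^ m := by
    rw [← Nat.card_eq_fintype_card, GaloisField.card p m hm0]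
  have hfinE : Module.finrank (ZMod p) E = m * r := by
    have h := Module.card_eq_pow_finrank (K := ZMod p) (V := E)
    rw [hE, ZMod.card] at h
    exact (Nat.pow_right_injective hp.two_le h).symm
  obtain ⟨φ⟩ := FiniteField.nonempty_algHom_of_finrank_dvd (F := ZMod p) (K := GaloisField p m)
    (L := E) (by rw [hfinE, GaloisField.finrank p hm0]; exact dvd_mul_right _ _)
  let _ : Algebra (GaloisField p m) E := φ.toRingHom.toAlgebra
  have : IsScalarTower (ZMod p) (GaloisField p m) E :=
    IsScalarTower.of_algebraMap_eq fun x => (φ.commutes x).symm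
  have hrank : Module.finrank (GaloisField p m) E = r := by
    have h := Module.finrank_mul_finrank (ZMod p) (GaloisField p m) E
    rw [hfinE, GaloisField.finrank p hm0] at h
    exact Nat.eq_of_mul_eq_mul_left (by omega) h
  have hinj := (algebraMap (GaloisField p m) E).injective
  obtain ⟨d, hd⟩ : ∃ d : GaloisField p m, algebraMap _ E d = (ω ^ k) ^ r := by
    obtain ⟨g, hg⟩ := exists_isPrimitiveRoot_of_card (hcq.trans hK.symm)
    have : NeZero (3 * c) := ⟨by omega⟩
    obtain ⟨i, -, hi⟩ := (hg.map_of_injective hinj).eq_pow_of_pow_eq_one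
      (ξ := (ω ^ k) ^ r) (by
        rw [← pow_mul, show r * (3 * c) = n * 3 by rw [hnrc]; ring, pow_mul, hβ.pow_eq_one,
          one_pow])
    exact ⟨g ^ i, by rw [map_pow, hi]⟩
  have hdprim : IsPrimitiveRoot d c := by
    apply IsPrimitiveRoot.of_map_of_injective (f := algebraMap (GaloisField p m) E) _ hinj
    rw [hd]
    exact hβ.pow (by rw [hnrc]; exact Nat.mul_pos hr.pos hc0) hnrc
  subst hm
  obtain ⟨W, hW0, hW1, hW2, hsum, hzero⟩ := exists_orbitWeight_distribution hp3 ht hK hcq hdprim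
    hAB hA1 hA
  have hlin : ∀ ℓ1 ℓ2 ℓ3 : ℕ, cubicWeight p t (3 * t) A B ℓ1 ℓ2 ℓ3
      = ((ℓ1 * W 0 + ℓ2 * W 1 + ℓ3 * W 2 : ℕ) : ℚ) := by
    intro ℓ1 ℓ2 ℓ3
    push_cast
    rw [hW0, hW1, hW2]
    simp only [cubicWeight]
    push_cast
    ring
  have hfreq : ∀ N : ℕ, freq p E ω k n N =
      ∑ ℓ ∈ Finset.range (r + 1) ×ˢ Finset.range (r + 1) ×ˢ Finset.range (r + 1),
        if ℓ.1 + ℓ.2.1 + ℓ.2.2 ≤ r ∧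
            (N : ℚ) = cubicWeight p t (3 * t) A B ℓ.1 ℓ.2.1 ℓ.2.2
        then Nat.choose r (ℓ.1 + ℓ.2.1 + ℓ.2.2) *
             Nat.multinomial Finset.univ ![ℓ.1, ℓ.2.1, ℓ.2.2] *
             c ^ (ℓ.1 + ℓ.2.1 + ℓ.2.2)
        else 0 := by
    intro N
    rw [freq_eq_card_filter hr h3r hrank (hcq.trans hK.symm) hc0 hnrc hβ hd hzero,
      card_filter_sum_eq_coeff, hsum (fun i => (Polynomial.X : Polynomial ℕ) ^ i), pow_zero,
      coeff_one_add_smul_pow]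
    simp only [hlin, Nat.cast_inj]
  refine ⟨?_, ?_, hfreq⟩
  · intro x hx
    have hpos : freq p E ω k n (wt x) ≠ 0 :=
      Finset.card_ne_zero_of_mem (Finset.mem_filter.mpr ⟨hx, rfl⟩)
    rw [hfreq] at hpos
    obtain ⟨ℓ, -, hℓ⟩ := Finset.exists_ne_zero_of_sum_ne_zero hpos
    by_cases h : ℓ.1 + ℓ.2.1 + ℓ.2.2 ≤ r ∧
        (wt x : ℚ) = cubicWeight p t (3 * t) A B ℓ.1 ℓ.2.1 ℓ.2.2
    · exact ⟨_, _, _, h⟩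
    · exact absurd (if_neg h) hℓ
  · intro ℓ1 ℓ2 ℓ3 hℓ
    rw [hlin]
    have hpos : freq p E ω k n (ℓ1 * W 0 + ℓ2 * W 1 + ℓ3 * W 2) ≠ 0 := by
      rw [hfreq]
      intro h0
      have h := Finset.sum_eq_zero_iff.mp h0 (ℓ1, ℓ2, ℓ3) (by
        simp only [Finset.mem_product, Finset.mem_range]
        omega)
      rw [if_pos ⟨hℓ, (hlin _ _ _).symm⟩] at h
      have h1 := Nat.choose_pos hℓ
      have h2 := Nat.multinomial_pos Finset.univ ![ℓ1, ℓ2, ℓ3]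
      have h3 := pow_pos hc0 (ℓ1 + ℓ2 + ℓ3)
      exact (Nat.mul_pos (Nat.mul_pos h1 h2) h3).ne' h
    obtain ⟨x, hx⟩ := Finset.card_pos.mp (Nat.pos_of_ne_zero hpos)
    rw [Finset.mem_filter] at hx
    exact ⟨x, hx.1, by rw [hx.2]⟩
end
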